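/- For all x ∈ Λ_A and all i ∈ {1,…,n}, the bar map satisfies bar(e_i·x) = e_i·bar(x), bar(f_i·x) = f_i·bar(x), and bar(k_i·x) = k_i⁻¹·bar(x). -/

import Mathlib

noncomputable section

/-- The ring `A = ℤ[q,q⁻¹]` of integer Laurent polynomials. -/
abbrev AL : Type := LaurentPolynomial ℤ

/-- The quantum parameter `q ∈ A`. -/
def qA : AL := LaurentPolynomial.T 1

/-- `q⁻¹ ∈ A`. -/
def qAinv : AL := LaurentPolynomial.T (-1)

/-- The index set `I = {1,…,n} ∪ {−n,…,−1}` as a finset of integers. -/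
def Iset (n : ℕ) : Finset ℤ := (Finset.Icc (-(n : ℤ)) (n : ℤ)).erase 0

/-- The type of generators, indexed by `I`. -/
abbrev Gen (n : ℕ) : Type := {x : ℤ // x ∈ Iset n}

/-- The generator of the free algebra indexed by `x ∈ I` (junk value `0` otherwise). -/
def gn (n : ℕ) (x : ℤ) : FreeAlgebra AL (Gen n) :=
  if h : x ∈ Iset n then FreeAlgebra.ι AL (⟨x, h⟩ : Gen n) else 0

/-- The defining relations of the quantum exterior algebra of type C. -/
inductive CRel (n : ℕ) : FreeAlgebra AL (Gen n) → FreeAlgebra AL (Gen n) → Prop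
  | sq (x : ℤ) (hx : x ∈ Iset n) : CRel n (gn n x * gn n x) 0
  | posSwap (i j : ℕ) (h1 : 1 ≤ i) (h2 : i < j) (h3 : j ≤ n) :
      CRel n (gn n (j : ℤ) * gn n (i : ℤ)) ((-qA) • (gn n (i : ℤ) * gn n (j : ℤ)))
  | negSwap (i j : ℕ) (h1 : 1 ≤ i) (h2 : i < j) (h3 : j ≤ n) :
      CRel n (gn n (-(i : ℤ)) * gn n (-(j : ℤ))) ((-qA) • (gn n (-(j : ℤ)) * gn n (-(i : ℤ))))
  | mixSwap (i j : ℕ) (h1 : 1 ≤ i) (h2 : i ≤ n) (h3 : 1 ≤ j) (h4 : j ≤ n) (h5 : i ≠ j) :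
      CRel n (gn n (-(i : ℤ)) * gn n (j : ℤ)) ((-qA) • (gn n (j : ℤ) * gn n (-(i : ℤ))))
  | main (i : ℕ) (h1 : 1 ≤ i) (h2 : i ≤ n) :
      CRel n (gn n (-(i : ℤ)) * gn n (i : ℤ))
        ((-(qA ^ 2)) • (gn n (i : ℤ) * gn n (-(i : ℤ))) +
          (qA - qAinv) •
            ∑ k ∈ Finset.Icc 1 (n - i),
              ((-qA) ^ (k + 1)) • (gn n ((i + k : ℕ) : ℤ) * gn n (-((i + k : ℕ) : ℤ))))

/-- The quantum exterior algebra of type C, `Λ_A`. -/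
abbrev LamAlg (n : ℕ) : Type := RingQuot (CRel n)

/-- The generator `v_x ∈ Λ_A`. -/
def va (n : ℕ) (x : ℤ) : LamAlg n := RingQuot.mkAlgHom AL (CRel n) (gn n x)

/-- The minimum of a nonempty finset of integers with respect to the order of `I`
(positives first, then negatives). -/
def iMin (S : Finset ℤ) (h : S.Nonempty) : ℤ :=
  if hp : (S.filter (fun x => 0 < x)).Nonempty then (S.filter (fun x => 0 < x)).min' hp
  else S.min' h

theorem iMin_mem (S : Finset ℤ) (h : S.Nonempty) : iMin S h ∈ S := by
  unfold iMin
  split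
  · exact Finset.mem_of_mem_filter _ (Finset.min'_mem _ _)
  · exact Finset.min'_mem _ _

/-- The maximum of a nonempty finset of integers with respect to the order of `I`. -/
def iMax (S : Finset ℤ) (h : S.Nonempty) : ℤ :=
  if hp : (S.filter (fun x => x < 0)).Nonempty then (S.filter (fun x => x < 0)).max' hp
  else S.max' h

theorem iMax_mem (S : Finset ℤ) (h : S.Nonempty) : iMax S h ∈ S := by
  unfold iMax
  split
  · exact Finset.mem_of_mem_filter _ (Finset.max'_mem _ _)
  · exact Finset.max'_mem _ _

/-- The standard monomial `v_S = v_{x_1} v_{x_2} ⋯ v_{x_m}` for `S = {x_1 < ⋯ < x_m}`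
(in the order of `I`). -/
def vset (n : ℕ) (S : Finset ℤ) : LamAlg n :=
  if h : S.Nonempty then va n (iMin S h) * vset n (S.erase (iMin S h)) else 1
termination_by S.card
decreasing_by exact Finset.card_erase_lt_of_mem (iMin_mem S h)

/-- The reversed standard monomial `v_S^{rev} = v_{x_m} ⋯ v_{x_2} v_{x_1}`. -/
def vsetRev (n : ℕ) (S : Finset ℤ) : LamAlg n :=
  if h : S.Nonempty then va n (iMax S h) * vsetRev n (S.erase (iMax S h)) else 1
termination_by S.card
decreasing_by exact Finset.card_erase_lt_of_mem (iMax_mem S h)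

/-- `−S`. -/
def negSet (S : Finset ℤ) : Finset ℤ := S.image (fun x => -x)

/-- The scalar appearing in the definition of the bar map. -/
def barScalar (S : Finset ℤ) : AL :=
  (-qAinv) ^ (S.card * (S.card - 1) / 2) *
    LaurentPolynomial.T (-(((S ∩ negSet S).card / 2 : ℕ) : ℤ))

/-- The four positions {i, i+1, −i, −(i+1)}. -/
def quad (i : ℤ) : Finset ℤ := {i, i + 1, -i, -(i + 1)}

/-- Coefficient of ε_j in wt(S). -/
def epsCoef (S : Finset ℤ) (j : ℤ) : ℤ :=
  (if j ∈ S then 1 else 0) - (if -j ∈ S then 1 else 0)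

/-- The pairing (α_i, wt S). -/
def alphaPair (n : ℕ) (i : ℤ) (S : Finset ℤ) : ℤ :=
  if i = (n : ℤ) then 2 * epsCoef S (n : ℤ) else epsCoef S i - epsCoef S (i + 1)

/-- The strict order on the index set `I`: positive indices come first. -/
def iLt (x y : ℤ) : Prop := (0 < x ∧ (y < 0 ∨ x < y)) ∨ (x < y ∧ y < 0)

theorem mem_Iset_iff {n : ℕ} {x : ℤ} : x ∈ Iset n ↔ x ≠ 0 ∧ -(n : ℤ) ≤ x ∧ x ≤ n := by
  simp [Iset]

/-- A family of elements of an algebra satisfying the relations of the quantum exterior algebra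
of type C, the last one in recursive form. -/
structure IsTypeCFamily (n : ℕ) {B : Type*} [Ring B] [Algebra AL B] (X : ℤ → B) : Prop where
  sq : ∀ x ∈ Iset n, X x * X x = 0
  swap : ∀ x ∈ Iset n, ∀ y ∈ Iset n, iLt x y → x + y ≠ 0 → X y * X x = (-qA) • (X x * X y)
  last : X (-(n : ℤ)) * X n = (-(qA ^ 2)) • (X n * X (-(n : ℤ)))
  step : ∀ i : ℤ, 1 ≤ i → i < n → X (-i) * X i + qA • (X (-(i + 1)) * X (i + 1)) +
    (qA ^ 2) • (X i * X (-i)) + qA • (X (i + 1) * X (-(i + 1))) = 0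

theorem qA_mul_qAinv : qA * qAinv = 1 := by
  rw [qA, qAinv, ← LaurentPolynomial.T_add, add_neg_cancel, LaurentPolynomial.T_zero]

theorem qAinv_mul_qA : qAinv * qA = 1 := by
  rw [mul_comm, qA_mul_qAinv]

theorem sum_Icc_one_succ_eq {M : Type*} [AddCommMonoid M] (m : ℕ) (g : ℕ → M) :
    ∑ k ∈ Finset.Icc 1 (m + 1), g k = g 1 + ∑ k ∈ Finset.Icc 1 m, g (k + 1) := by
  have h (m : ℕ) (g : ℕ → M) : ∑ k ∈ Finset.Icc 1 m, g k = ∑ k ∈ Finset.range m, g (k + 1) := by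
    rw [Finset.range_eq_Ico, Finset.sum_Ico_add' g 0 m 1]
    rfl
  rw [h, h, Finset.sum_range_succ', add_comm]

theorem sum_pow_smul_mul_shift {B : Type*} [Ring B] [Algebra AL B] (X : ℤ → B) (i : ℤ) (m : ℕ) :
    ∑ k ∈ Finset.Icc 1 m, (-qA) ^ (k + 1 + 1) •
        (X (i + ((k : ℤ) + 1)) * X (-(i + ((k : ℤ) + 1)))) =
      (-qA) • ∑ k ∈ Finset.Icc 1 m, (-qA) ^ (k + 1) • (X (i + 1 + k) * X (-(i + 1 + k))) := by
  rw [Finset.smul_sum]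
  refine Finset.sum_congr rfl fun k _ => ?_
  rw [smul_smul, pow_succ' _ (k + 1)]
  congr 3 <;> ring_nf

section Family

variable {n : ℕ} {B : Type*} [Ring B] [Algebra AL B] {X : ℤ → B}

theorem IsTypeCFamily.mul_neg_expand (hX : IsTypeCFamily n X) (m i : ℕ) (h1 : 1 ≤ i) (h :
    i + m = n) :
    X (-(i : ℤ)) * X i = (-(qA ^ 2)) • (X i * X (-(i : ℤ))) + (qA - qAinv) •
      ∑ k ∈ Finset.Icc 1 m,
        ((-qA) ^ (k + 1)) • (X ((i + k : ℕ) : ℤ) * X (-((i + k : ℕ) : ℤ))) := by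
  induction m generalizing i with
  | zero =>
    obtain rfl : i = n := by omega
    simpa using hX.last
  | succ m ih =>
    have hstep := hX.step i (by omega) (by omega)
    have hi := ih (i + 1) (by omega) (by omega)
    rw [sum_Icc_one_succ_eq]
    push_cast at hi hstep ⊢
    rw [hi] at hstep
    rw [sum_pow_smul_mul_shift]
    generalize ∑ k ∈ Finset.Icc 1 m, (-qA) ^ (k + 1) •
          (X ((i : ℤ) + 1 + k) * X (-((i : ℤ) + 1 + k))) = s at *
    rw [add_assoc, add_assoc, add_eq_zero_iff_eq_neg] at hstep
    rw [hstep]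
    have hq := qA_mul_qAinv
    match_scalars
    · linear_combination qA * hq
    · ring
    · ring

theorem step_of_mul_neg_expand {i : ℤ} {m : ℕ}
    (hi : X (-(i + 1)) * X (i + 1) = (-(qA ^ 2)) • (X (i + 1) * X (-(i + 1))) + (qA - qAinv) •
      ∑ k ∈ Finset.Icc 1 m, ((-qA) ^ (k + 1)) • (X (i + 1 + k) * X (-(i + 1 + k))))
    (hstep : X (-i) * X i = (-(qA ^ 2)) • (X i * X (-i)) + (qA - qAinv) •
      ((-qA) ^ (1 + 1) • (X (i + 1) * X (-(i + 1))) + ∑ k ∈ Finset.Icc 1 m,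
        ((-qA) ^ (k + 1 + 1)) • (X (i + ((k : ℤ) + 1)) * X (-(i + ((k : ℤ) + 1)))))) :
    X (-i) * X i + qA • (X (-(i + 1)) * X (i + 1)) +
      (qA ^ 2) • (X i * X (-i)) + qA • (X (i + 1) * X (-(i + 1))) = 0 := by
  rw [sum_pow_smul_mul_shift] at hstep
  rw [hi, hstep]
  have hq := qA_mul_qAinv
  match_scalars
  · ring
  · linear_combination (-qA) * hq
  · ring

theorem IsTypeCFamily.step_mul (hX : IsTypeCFamily n X) {i : ℤ} (h1 : 1 ≤ i) (h2 : i < n) (b : B) :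
    X (-i) * X i * b = (-qA) • (X (-(i + 1)) * (X (i + 1) * b)) +
      ((-(qA ^ 2)) • (X i * (X (-i) * b)) + (-qA) • (X (i + 1) * (X (-(i + 1)) * b))) := by
  have h := congrArg (· * b) (hX.step i h1 h2)
  simp only [add_mul, smul_mul_assoc, zero_mul, mul_assoc] at h
  rw [add_assoc, add_assoc, add_eq_zero_iff_eq_neg] at h
  rw [mul_assoc, h]
  module

/-- A family satisfying the relations of type C extends to the quantum exterior algebra. -/
theorem IsTypeCFamily.exists_lift (hX : IsTypeCFamily n X) :
    ∃ φ : LamAlg n →ₐ[AL] B, ∀ x ∈ Iset n, φ (va n x) = X x := by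
  let ψ : FreeAlgebra AL (Gen n) →ₐ[AL] B := FreeAlgebra.lift AL fun x : Gen n => X x
  have hψ (x : ℤ) (hx : x ∈ Iset n) : ψ (gn n x) = X x := by
    simp [ψ, gn, hx]
  have hp (i : ℕ) (h1 : 1 ≤ i) (h2 : i ≤ n) : ψ (gn n i) = X i :=
    hψ _ (by rw [mem_Iset_iff]; omega)
  have hm (i : ℕ) (h1 : 1 ≤ i) (h2 : i ≤ n) : ψ (gn n (-(i : ℤ))) = X (-(i : ℤ)) :=
    hψ _ (by rw [mem_Iset_iff]; omega)
  have hrel : ∀ ⦃a b⦄, CRel n a b → ψ a = ψ b := by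
    intro a b hab
    induction hab with
    | sq x hx => rw [map_mul, hψ x hx, hX.sq x hx, map_zero]
    | posSwap i j h1 h2 h3 =>
      rw [map_smul, map_mul, map_mul, hp i (by omega) (by omega), hp j (by omega) (by omega)]
      exact hX.swap _ (by rw [mem_Iset_iff]; omega) _ (by rw [mem_Iset_iff]; omega)
        (by unfold iLt; omega) (by omega)
    | negSwap i j h1 h2 h3 =>
      rw [map_smul, map_mul, map_mul, hm i (by omega) (by omega), hm j (by omega) (by omega)]
      exact hX.swap _ (by rw [mem_Iset_iff]; omega) _ (by rw [mem_Iset_iff]; omega)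
        (by unfold iLt; omega) (by omega)
    | mixSwap i j h1 h2 h3 h4 h5 =>
      rw [map_smul, map_mul, map_mul, hm i (by omega) (by omega), hp j (by omega) (by omega)]
      exact hX.swap _ (by rw [mem_Iset_iff]; omega) _ (by rw [mem_Iset_iff]; omega)
        (by unfold iLt; omega) (by omega)
    | main i h1 h2 =>
      rw [map_add, map_smul, map_smul, map_sum, map_mul, map_mul, hp i h1 h2, hm i h1 h2,
        hX.mul_neg_expand (n - i) i h1 (by omega)]
      congr 2
      refine Finset.sum_congr rfl fun k hk => ?_
      rw [Finset.mem_Icc] at hk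
      rw [map_smul, map_mul, hp (i + k) (by omega) (by omega), hm (i + k) (by omega) (by omega)]
  refine ⟨RingQuot.liftAlgHom AL ⟨ψ, hrel⟩, fun x hx => ?_⟩
  rw [va, RingQuot.liftAlgHom_mkAlgHom_apply, hψ x hx]

end Family

theorem lamAlg_sum_rel {n : ℕ} (i m : ℕ) (h1 : 1 ≤ i) (h : i + m = n) :
    va n (-(i : ℤ)) * va n i = (-(qA ^ 2)) • (va n i * va n (-(i : ℤ))) + (qA - qAinv) •
      ∑ k ∈ Finset.Icc 1 m,
        ((-qA) ^ (k + 1)) • (va n ((i + k : ℕ) : ℤ) * va n (-((i + k : ℕ) : ℤ))) := by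
  have := RingQuot.mkAlgHom_rel AL (CRel.main i h1 (by omega : i ≤ n))
  rw [map_add, map_smul, map_smul, map_sum, map_mul, map_mul] at this
  simp only [map_smul, map_mul] at this
  rw [show n - i = m by omega] at this
  exact this

/-- The generators of the quantum exterior algebra form a family of type C. -/
theorem isTypeCFamily_va (n : ℕ) (hn : 1 ≤ n) : IsTypeCFamily n (va n) where
  sq x hx := by
    have := RingQuot.mkAlgHom_rel AL (CRel.sq x hx)
    rwa [map_mul, map_zero] at this
  swap x hx y hy hxy h0 := by
    rw [mem_Iset_iff] at hx hy
    unfold iLt at hxy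
    rcases lt_or_gt_of_ne hx.1 with hx0 | hx0 <;> rcases lt_or_gt_of_ne hy.1 with hy0 | hy0
    · obtain ⟨i, rfl⟩ : ∃ i : ℕ, x = -i := ⟨(-x).toNat, by omega⟩
      obtain ⟨j, rfl⟩ : ∃ j : ℕ, y = -j := ⟨(-y).toNat, by omega⟩
      have := RingQuot.mkAlgHom_rel AL
        (CRel.negSwap (n := n) j i (by omega) (by omega) (by omega))
      rwa [map_smul, map_mul, map_mul] at this
    · omega
    · obtain ⟨i, rfl⟩ : ∃ i : ℕ, x = i := ⟨x.toNat, by omega⟩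
      obtain ⟨j, rfl⟩ : ∃ j : ℕ, y = -j := ⟨(-y).toNat, by omega⟩
      have := RingQuot.mkAlgHom_rel AL
        (CRel.mixSwap (n := n) j i (by omega) (by omega) (by omega) (by omega) (by omega))
      rwa [map_smul, map_mul, map_mul] at this
    · obtain ⟨i, rfl⟩ : ∃ i : ℕ, x = i := ⟨x.toNat, by omega⟩
      obtain ⟨j, rfl⟩ : ∃ j : ℕ, y = j := ⟨y.toNat, by omega⟩
      have := RingQuot.mkAlgHom_rel AL
        (CRel.posSwap (n := n) i j (by omega) (by omega) (by omega))
      rwa [map_smul, map_mul, map_mul] at this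
  last := by simpa using lamAlg_sum_rel n 0 hn (add_zero n)
  step i h1 h2 := by
    obtain ⟨i, rfl⟩ : ∃ j : ℕ, i = j := ⟨i.toNat, by omega⟩
    obtain ⟨m, rfl⟩ : ∃ m, n = i + (m + 1) := ⟨n - i - 1, by omega⟩
    have hstep := lamAlg_sum_rel i (m + 1) (by omega) rfl
    have hi := lamAlg_sum_rel (n := i + (m + 1)) (i + 1) m (by omega) (by omega)
    rw [sum_Icc_one_succ_eq] at hstep
    push_cast at hi hstep ⊢
    exact step_of_mul_neg_expand hi hstep

theorem LamAlg.induction_on {n : ℕ} {P : LamAlg n → Prop} (x : LamAlg n)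
    (scalar : ∀ r : AL, P (algebraMap AL _ r)) (gen : ∀ y ∈ Iset n, P (va n y))
    (mul : ∀ a b, P a → P b → P (a * b)) (add : ∀ a b, P a → P b → P (a + b)) : P x := by
  obtain ⟨a, rfl⟩ := RingQuot.mkAlgHom_surjective AL (CRel n) x
  induction a using FreeAlgebra.induction with
  | grade0 r => rw [AlgHom.commutes]; exact scalar r
  | grade1 y =>
    have := gen y.1 y.2
    rwa [va, gn, dif_pos y.2] at this
  | mul a b ha hb => rw [map_mul]; exact mul _ _ ha hb
  | add a b ha hb => rw [map_add]; exact add _ _ ha hb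

/-- The elements of `I` in increasing order. -/
def orderList (n : ℕ) : List ℤ :=
  (List.range' 1 n).map (fun k : ℕ => (k : ℤ)) ++
    ((List.range' 1 n).map (fun k : ℕ => -(k : ℤ))).reverse

theorem mem_orderList {n : ℕ} {x : ℤ} : x ∈ orderList n ↔ x ∈ Iset n := by
  simp only [orderList, List.mem_append, List.mem_reverse, List.mem_map, List.mem_range'_1,
    mem_Iset_iff]
  constructor
  · rintro (⟨k, hk, rfl⟩ | ⟨k, hk, rfl⟩) <;> omega
  · rintro ⟨h0, h1, h2⟩
    rcases lt_or_gt_of_ne h0 with h | h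
    · exact Or.inr ⟨(-x).toNat, by omega, by omega⟩
    · exact Or.inl ⟨x.toNat, by omega, by omega⟩

theorem pairwise_orderList (n : ℕ) : (orderList n).Pairwise iLt := by
  have h : (List.range' 1 n).Pairwise (· < ·) := List.pairwise_lt_range'
  rw [orderList, List.pairwise_append, List.pairwise_reverse, List.pairwise_map, List.pairwise_map]
  refine ⟨?_, ?_, ?_⟩
  · refine h.imp_of_mem fun {a b} ha hb hab => ?_
    rw [List.mem_range'_1] at ha hb
    unfold iLt; omega
  · refine h.imp_of_mem fun {a b} ha hb hab => ?_
    rw [List.mem_range'_1] at ha hb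
    unfold iLt; omega
  · simp only [List.mem_reverse, List.mem_map, List.mem_range'_1]
    rintro _ ⟨a, ha, rfl⟩ _ ⟨b, hb, rfl⟩
    unfold iLt; omega

theorem iMin_eq_of_forall {S : Finset ℤ} {h : S.Nonempty} {x : ℤ} (h0 : 0 ∉ S) (hx : x ∈ S)
    (hle : ∀ y ∈ S, y = x ∨ iLt x y) : iMin S h = x := by
  unfold iLt at hle
  unfold iMin
  split
  · next hp =>
    obtain ⟨y, hy⟩ := id hp
    rw [Finset.mem_filter] at hy
    have hx0 : 0 < x := by have := hle y hy.1; omega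
    refine le_antisymm (Finset.min'_le _ _ (by simp [hx, hx0])) (Finset.le_min' _ _ _ ?_)
    intro z hz
    rw [Finset.mem_filter] at hz
    have := hle z hz.1
    omega
  · next hp =>
    have hneg : ∀ y ∈ S, y < 0 := by
      intro y hy
      by_contra hc
      refine hp ⟨y, Finset.mem_filter.2 ⟨hy, ?_⟩⟩
      have : y ≠ 0 := fun h => h0 (h ▸ hy)
      omega
    refine le_antisymm (Finset.min'_le _ _ hx) (Finset.le_min' _ _ _ ?_)
    intro z hz
    have := hle z hz
    have := hneg z hz
    have := hneg x hx
    omega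

theorem iMax_eq_of_forall {S : Finset ℤ} {h : S.Nonempty} {x : ℤ} (h0 : 0 ∉ S) (hx : x ∈ S)
    (hle : ∀ y ∈ S, y = x ∨ iLt y x) : iMax S h = x := by
  unfold iLt at hle
  unfold iMax
  split
  · next hp =>
    obtain ⟨y, hy⟩ := id hp
    rw [Finset.mem_filter] at hy
    have hx0 : x < 0 := by have := hle y hy.1; omega
    refine le_antisymm (Finset.max'_le _ _ _ ?_) (Finset.le_max' _ _ (by simp [hx, hx0]))
    intro z hz
    rw [Finset.mem_filter] at hz
    have := hle z hz.1
    omega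
  · next hp =>
    have hpos : ∀ y ∈ S, 0 < y := by
      intro y hy
      by_contra hc
      refine hp ⟨y, Finset.mem_filter.2 ⟨hy, ?_⟩⟩
      have : y ≠ 0 := fun h => h0 (h ▸ hy)
      omega
    refine le_antisymm (Finset.max'_le _ _ _ ?_) (Finset.le_max' _ _ hx)
    intro z hz
    have := hle z hz
    have := hpos z hz
    have := hpos x hx
    omega

theorem iLt_irrefl (x : ℤ) : ¬ iLt x x := by
  unfold iLt; omega

theorem vset_toFinset (n : ℕ) {l : List ℤ} (hl : l.Pairwise iLt) (h0 : 0 ∉ l) :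
    vset n l.toFinset = (l.map (va n)).prod := by
  induction l with
  | nil => rw [vset]; simp
  | cons x t ih =>
    rw [List.pairwise_cons] at hl
    have hne : (x :: t).toFinset.Nonempty := ⟨x, by simp⟩
    have hmin : iMin (x :: t).toFinset hne = x := by
      refine iMin_eq_of_forall (by simpa using h0) (by simp) fun y hy => ?_
      rw [List.mem_toFinset, List.mem_cons] at hy
      exact hy.imp id (hl.1 y)
    have hx : x ∉ t := fun hx => iLt_irrefl x (hl.1 x hx)
    rw [vset, dif_pos hne, hmin, List.toFinset_cons, Finset.erase_insert (by simpa using hx),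
      ih hl.2 fun h => h0 (List.mem_cons_of_mem _ h), List.map_cons, List.prod_cons]

theorem vsetRev_toFinset (n : ℕ) {l : List ℤ} (hl : l.Pairwise fun x y => iLt y x) (h0 : 0 ∉ l) :
    vsetRev n l.toFinset = (l.map (va n)).prod := by
  induction l with
  | nil => rw [vsetRev]; simp
  | cons x t ih =>
    rw [List.pairwise_cons] at hl
    have hne : (x :: t).toFinset.Nonempty := ⟨x, by simp⟩
    have hmax : iMax (x :: t).toFinset hne = x := by
      refine iMax_eq_of_forall (by simpa using h0) (by simp) fun y hy => ?_
      rw [List.mem_toFinset, List.mem_cons] at hy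
      exact hy.imp id (hl.1 y)
    have hx : x ∉ t := fun hx => iLt_irrefl x (hl.1 x hx)
    rw [vsetRev, dif_pos hne, hmax, List.toFinset_cons, Finset.erase_insert (by simpa using hx),
      ih hl.2 fun h => h0 (List.mem_cons_of_mem _ h), List.map_cons, List.prod_cons]

/-- The factor of a monomial indexed by `S` at the position `x`. -/
def vfac (n : ℕ) (S : Finset ℤ) (x : ℤ) : LamAlg n := if x ∈ S then va n x else 1

theorem prod_map_filter_va (n : ℕ) (S : Finset ℤ) (l : List ℤ) :
    ((l.filter (· ∈ S)).map (va n)).prod = (l.map (vfac n S)).prod := by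
  induction l with
  | nil => rfl
  | cons x t ih => by_cases hx : x ∈ S <;> simp [hx, vfac, ih]

theorem zero_notMem_orderList (n : ℕ) : (0 : ℤ) ∉ orderList n := by
  rw [mem_orderList, mem_Iset_iff]; simp

theorem vset_eq_prod {n : ℕ} {S : Finset ℤ} (hS : S ⊆ Iset n) :
    vset n S = ((orderList n).map (vfac n S)).prod := by
  rw [← prod_map_filter_va, ← vset_toFinset n ((pairwise_orderList n).filter _)
    fun h => zero_notMem_orderList n (List.mem_of_mem_filter h)]
  congr 1
  ext x
  simpa [mem_orderList] using @hS x

theorem vsetRev_eq_prod {n : ℕ} {S : Finset ℤ} (hS : S ⊆ Iset n) :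
    vsetRev n S = ((orderList n).reverse.map (vfac n S)).prod := by
  rw [← prod_map_filter_va, ← vsetRev_toFinset n
    ((List.pairwise_reverse.2 (pairwise_orderList n)).filter _)
    fun h => zero_notMem_orderList n (List.mem_reverse.1 (List.mem_of_mem_filter h))]
  congr 1
  ext x
  simpa [mem_orderList] using @hS x

/-- The span of the ordered monomials in the generators from a list. -/
def monomialSpan (n : ℕ) : List ℤ → Submodule AL (LamAlg n)
  | [] => Submodule.span AL {1}
  | x :: t => monomialSpan n t ⊔ (monomialSpan n t).map (LinearMap.mulLeft AL (va n x))

theorem one_mem_monomialSpan (n : ℕ) (l : List ℤ) : 1 ∈ monomialSpan n l := by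
  induction l with
  | nil => exact Submodule.mem_span_singleton_self 1
  | cons x t ih => exact Submodule.mem_sup_left ih

theorem monomialSpan_le {n : ℕ} {W : Submodule AL (LamAlg n)} {l : List ℤ} {a : LamAlg n}
    (h : ∀ s : List ℤ, s.Sublist l → a * (s.map (va n)).prod ∈ W) {w : LamAlg n}
    (hw : w ∈ monomialSpan n l) : a * w ∈ W := by
  induction l generalizing a w with
  | nil =>
    obtain ⟨c, rfl⟩ := Submodule.mem_span_singleton.1 hw
    rw [mul_smul_comm]
    exact W.smul_mem _ (by simpa using h [] (List.Sublist.refl _))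
  | cons x t ih =>
    obtain ⟨y, hy, z, hz, rfl⟩ := Submodule.mem_sup.1 hw
    obtain ⟨z, hz', rfl⟩ := Submodule.mem_map.1 hz
    rw [mul_add]
    refine W.add_mem (ih (fun s hs => h s (hs.cons x)) hy) ?_
    rw [LinearMap.mulLeft_apply, ← mul_assoc]
    refine ih (fun s hs => ?_) hz'
    rw [mul_assoc]
    simpa using h (x :: s) (hs.cons_cons x)

/-- Straightening: the span of the ordered monomials in a final segment of the generators is
stable under left multiplication by these generators. -/
theorem va_mul_mem_monomialSpan {n : ℕ} (hn : 1 ≤ n) {l : List ℤ} (hl : l.Pairwise iLt)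
    (hI : ∀ x ∈ l, x ∈ Iset n) (hup : ∀ x ∈ l, ∀ y ∈ Iset n, iLt x y → y ∈ l) :
    ∀ x ∈ l, ∀ w ∈ monomialSpan n l, va n x * w ∈ monomialSpan n l := by
  induction l with
  | nil => simp
  | cons y t ih =>
    rw [List.pairwise_cons] at hl
    have hX := isTypeCFamily_va n hn
    have hyI := hI y List.mem_cons_self
    have ht := ih hl.2 (fun x hx => hI x (List.mem_cons_of_mem _ hx)) fun x hx z hz hxz => by
      rcases List.mem_cons.1 (hup x (List.mem_cons_of_mem _ hx) z hz hxz) with rfl | h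
      · have := hl.1 x hx
        rw [mem_Iset_iff] at hz
        unfold iLt at *
        omega
      · exact h
    have hleft {w} (hw : w ∈ monomialSpan n t) : w ∈ monomialSpan n (y :: t) :=
      Submodule.mem_sup_left hw
    have hright {w} (hw : w ∈ monomialSpan n t) : va n y * w ∈ monomialSpan n (y :: t) :=
      Submodule.mem_sup_right (Submodule.mem_map_of_mem hw)
    have hmem {z} (hz : z ∈ Iset n) (hyz : iLt y z) : z ∈ t := by
      rcases List.mem_cons.1 (hup y List.mem_cons_self z hz hyz) with rfl | h
      · exact (iLt_irrefl z hyz).elim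
      · exact h
    intro x hx w hw
    obtain ⟨a, ha, b, hb, rfl⟩ := Submodule.mem_sup.1 hw
    obtain ⟨b, hb', rfl⟩ := Submodule.mem_map.1 hb
    rw [mul_add, LinearMap.mulLeft_apply, ← mul_assoc]
    rcases List.mem_cons.1 hx with rfl | hx
    · rw [hX.sq x hyI, zero_mul, add_zero]
      exact hright ha
    refine Submodule.add_mem _ (hleft (ht x hx a ha)) ?_
    have hxI := hI x (List.mem_cons_of_mem _ hx)
    have hyx := hl.1 x hx
    by_cases h0 : y + x = 0
    · obtain rfl : x = -y := by omega
      rw [mem_Iset_iff] at hxI hyI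
      have hy0 : 1 ≤ y := by unfold iLt at hyx; omega
      by_cases hyn : y = n
      · subst hyn
        rw [hX.last, smul_mul_assoc, mul_assoc]
        exact Submodule.smul_mem _ _ (hright (ht _ hx b hb'))
      · rw [hX.step_mul hy0 (by omega)]
        have h1 : y + 1 ∈ t :=
          hmem (by rw [mem_Iset_iff]; omega) (by unfold iLt; omega)
        have h2 : -(y + 1) ∈ t :=
          hmem (by rw [mem_Iset_iff]; omega) (by unfold iLt; omega)
        refine Submodule.add_mem _ ?_ (Submodule.add_mem _ ?_ ?_) <;>
          refine Submodule.smul_mem _ _ ?_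
        · exact hleft (ht _ h2 _ (ht _ h1 b hb'))
        · exact hright (ht _ hx b hb')
        · exact hleft (ht _ h1 _ (ht _ h2 b hb'))
    · rw [hX.swap y hyI x hxI hyx h0, smul_mul_assoc, mul_assoc]
      exact Submodule.smul_mem _ _ (hright (ht x hx b hb'))

/-- The standard monomials span the quantum exterior algebra. -/
theorem span_vset_eq_top {n : ℕ} (hn : 1 ≤ n) :
    Submodule.span AL (vset n '' {S | S ⊆ Iset n}) = ⊤ := by
  rw [Submodule.eq_top_iff']
  intro x
  have key (x : LamAlg n) : ∀ w ∈ monomialSpan n (orderList n),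
      x * w ∈ monomialSpan n (orderList n) := by
    induction x using LamAlg.induction_on with
    | scalar r =>
      intro w hw
      rw [← Algebra.smul_def]
      exact Submodule.smul_mem _ _ hw
    | gen y hy =>
      exact va_mul_mem_monomialSpan hn (pairwise_orderList n) (fun x hx => mem_orderList.1 hx)
        (fun x _ y hy _ => mem_orderList.2 hy) y (mem_orderList.2 hy)
    | mul a b ha hb =>
      intro w hw
      rw [mul_assoc]
      exact ha _ (hb w hw)
    | add a b ha hb =>
      intro w hw
      rw [add_mul]
      exact Submodule.add_mem _ (ha w hw) (hb w hw)
  have hx := key x 1 (one_mem_monomialSpan n _)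
  rw [mul_one] at hx
  rw [← one_mul x]
  refine monomialSpan_le (fun s hs => ?_) hx
  rw [one_mul, ← vset_toFinset n ((pairwise_orderList n).sublist hs)
    fun h => zero_notMem_orderList n (hs.subset h)]
  refine Submodule.subset_span ⟨_, fun y hy => ?_, rfl⟩
  exact mem_orderList.1 (hs.subset (List.mem_toFinset.1 hy))

section TwistedDerivation

variable {n : ℕ} {B : Type*} [Ring B] [Algebra AL B] {X : ℤ → B}

theorem IsTypeCFamily.smul (hX : IsTypeCFamily n X) {u : ℤ → ℤ} (hu : ∀ x, u (-x) = -u x) :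
    IsTypeCFamily n fun x => (LaurentPolynomial.T (u x) : AL) • X x := by
  have hmul (x y : ℤ) : ((LaurentPolynomial.T (u x) : AL) • X x) *
      ((LaurentPolynomial.T (u y) : AL) • X y) =
      (LaurentPolynomial.T (u x + u y) : AL) • (X x * X y) := by
    rw [smul_mul_smul_comm, LaurentPolynomial.T_add]
  constructor
  · intro x hx
    rw [hmul, hX.sq x hx, smul_zero]
  · intro x hx y hy hxy h0
    rw [hmul, hmul, hX.swap x hx y hy hxy h0, smul_comm, add_comm]
  · rw [hmul, hmul, hX.last, smul_comm, add_comm]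
  · intro i h1 h2
    rw [hmul, hmul, hmul, hmul]
    simp only [hu, neg_add_cancel, add_neg_cancel, LaurentPolynomial.T_zero, one_smul]
    exact hX.step i h1 h2

/-- The value on `X x * X y` of the `(u, w)`-twisted derivation with values `d` on the family. -/
def twistedLeibniz (u w : ℤ → ℤ) (X d : ℤ → B) (x y : ℤ) : B :=
  (LaurentPolynomial.T (u x) : AL) • (X x * d y) + (LaurentPolynomial.T (w y) : AL) • (d x * X y)

/-- The values `d` are compatible with the defining relations. -/
structure IsCompatible (n : ℕ) (u w : ℤ → ℤ) (X d : ℤ → B) : Prop where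
  left_neg : ∀ x, u (-x) = -u x
  right_neg : ∀ x, w (-x) = -w x
  sq : ∀ x ∈ Iset n, twistedLeibniz u w X d x x = 0
  swap : ∀ x ∈ Iset n, ∀ y ∈ Iset n, iLt x y → x + y ≠ 0 →
    twistedLeibniz u w X d y x = (-qA) • twistedLeibniz u w X d x y
  last : twistedLeibniz u w X d (-(n : ℤ)) n = (-(qA ^ 2)) • twistedLeibniz u w X d n (-(n : ℤ))
  step : ∀ i : ℤ, 1 ≤ i → i < n →
    twistedLeibniz u w X d (-i) i + qA • twistedLeibniz u w X d (-(i + 1)) (i + 1) +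
    (qA ^ 2) • twistedLeibniz u w X d i (-i) +
    qA • twistedLeibniz u w X d (i + 1) (-(i + 1)) = 0

/-- The upper triangular matrices encoding a twisted derivation. -/
def triangular (u w : ℤ → ℤ) (X d : ℤ → B) (x : ℤ) : Matrix (Fin 2) (Fin 2) B :=
  !![(LaurentPolynomial.T (u x) : AL) • X x, d x; 0, (LaurentPolynomial.T (w x) : AL) • X x]

theorem triangular_mul (u w : ℤ → ℤ) (X d : ℤ → B) (x y : ℤ) :
    triangular u w X d x * triangular u w X d y =
      !![((LaurentPolynomial.T (u x) : AL) • X x) * ((LaurentPolynomial.T (u y) : AL) • X y),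
        twistedLeibniz u w X d x y;
        0, ((LaurentPolynomial.T (w x) : AL) • X x) * ((LaurentPolynomial.T (w y) : AL) • X y)] := by
  rw [triangular, triangular, Matrix.mul_fin_two]
  simp [twistedLeibniz]

theorem IsTypeCFamily.triangular (hX : IsTypeCFamily n X) {u w : ℤ → ℤ} {d : ℤ → B}
    (hd : IsCompatible n u w X d) : IsTypeCFamily n (triangular u w X d) := by
  have hU := hX.smul hd.left_neg
  have hW := hX.smul hd.right_neg
  constructor
  · intro x hx
    rw [triangular_mul, hU.sq x hx, hW.sq x hx, hd.sq x hx]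
    ext i j; fin_cases i <;> fin_cases j <;> rfl
  · intro x hx y hy hxy h0
    rw [triangular_mul, triangular_mul, hU.swap x hx y hy hxy h0, hW.swap x hx y hy hxy h0,
      hd.swap x hx y hy hxy h0]
    ext i j; fin_cases i <;> fin_cases j <;> simp
  · rw [triangular_mul, triangular_mul, hU.last, hW.last, hd.last]
    ext i j; fin_cases i <;> fin_cases j <;> simp
  · intro i h1 h2
    simp only [triangular_mul]
    ext a b
    fin_cases a <;> fin_cases b
    · exact hU.step i h1 h2
    · exact hd.step i h1 h2
    · simp
    · exact hW.step i h1 h2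

end TwistedDerivation

/-- `D` is a `(U, W)`-twisted derivation, with prescribed values on generators. -/
structure IsTwistedDerivation (n : ℕ) (u w : ℤ → ℤ) (d : ℤ → LamAlg n)
    (U W : LamAlg n →ₐ[AL] LamAlg n) (D : LamAlg n →ₗ[AL] LamAlg n) : Prop where
  map_one : D 1 = 0
  map_mul : ∀ a b, D (a * b) = U a * D b + D a * W b
  map_va : ∀ x ∈ Iset n, D (va n x) = d x
  left_va : ∀ x ∈ Iset n, U (va n x) = (LaurentPolynomial.T (u x) : AL) • va n x
  right_va : ∀ x ∈ Iset n, W (va n x) = (LaurentPolynomial.T (w x) : AL) • va n x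

theorem exists_isTwistedDerivation {n : ℕ} (hn : 1 ≤ n) {u w : ℤ → ℤ} {d : ℤ → LamAlg n}
    (hd : IsCompatible n u w (va n) d) :
    ∃ U W D, IsTwistedDerivation n u w d U W D := by
  have hX := isTypeCFamily_va n hn
  obtain ⟨U, hU⟩ := (hX.smul hd.left_neg).exists_lift
  obtain ⟨W, hW⟩ := (hX.smul hd.right_neg).exists_lift
  obtain ⟨θ, hθ⟩ := (hX.triangular hd).exists_lift
  have key (a : LamAlg n) : θ a 0 0 = U a ∧ θ a 1 0 = 0 ∧ θ a 1 1 = W a := by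
    induction a using LamAlg.induction_on with
    | scalar r => simp [Matrix.algebraMap_matrix_apply]
    | gen y hy => rw [hθ y hy, hU y hy, hW y hy]; simp [triangular]
    | mul a b ha hb => simp [Matrix.mul_apply, ha, hb]
    | add a b ha hb => simp [ha, hb]
  refine ⟨U, W, Matrix.entryLinearMap AL _ 0 1 ∘ₗ θ.toLinearMap, ?_, fun a b => ?_,
    fun x hx => ?_, hU, hW⟩
  · simp
  · simp [Matrix.mul_apply, key]
  · simp [hθ x hx, triangular]

/-- The pairing of the simple root `α_i` with the weight of `v_x`. -/
def rootWt (n : ℕ) (i x : ℤ) : ℤ :=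
  if i = n then (if x = i then 2 else if x = -i then -2 else 0)
  else if x = i ∨ x = -(i + 1) then 1 else if x = i + 1 ∨ x = -i then -1 else 0

/-- The action of `f_i` on the generators. -/
def fGen (n : ℕ) (i x : ℤ) : LamAlg n :=
  if i = n then (if x = i then va n (-i) else 0)
  else if x = i then va n (i + 1) else if x = -(i + 1) then va n (-i) else 0

/-- The action of `e_i` on the generators. -/
def eGen (n : ℕ) (i x : ℤ) : LamAlg n :=
  if i = n then (if x = -i then va n i else 0)
  else if x = i + 1 then va n i else if x = -i then va n (-(i + 1)) else 0

theorem rootWt_neg {n : ℕ} {i : ℤ} (hi : 1 ≤ i) (x : ℤ) : rootWt n i (-x) = -rootWt n i x := by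
  unfold rootWt
  split_ifs <;> omega

theorem fGen_left {n : ℕ} {i : ℤ} (hin : i < n) : fGen n i i = va n (i + 1) := by
  simp [fGen, hin.ne]

theorem fGen_right {n : ℕ} {i : ℤ} (hi : 1 ≤ i) (hin : i < n) :
    fGen n i (-(i + 1)) = va n (-i) := by
  rw [fGen, if_neg (by omega), if_neg (by omega), if_pos rfl]

theorem fGen_of_ne {n : ℕ} {i : ℤ} (hin : i < n) {x : ℤ} (h1 : x ≠ i) (h2 : x ≠ -(i + 1)) :
    fGen n i x = 0 := by
  rw [fGen, if_neg (by omega), if_neg h1, if_neg h2]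

theorem eGen_left {n : ℕ} {i : ℤ} (hin : i < n) : eGen n i (i + 1) = va n i := by
  simp [eGen, hin.ne]

theorem eGen_right {n : ℕ} {i : ℤ} (hi : 1 ≤ i) (hin : i < n) :
    eGen n i (-i) = va n (-(i + 1)) := by
  rw [eGen, if_neg (by omega), if_neg (by omega), if_pos rfl]

theorem eGen_of_ne {n : ℕ} {i : ℤ} (hin : i < n) {x : ℤ} (h1 : x ≠ i + 1) (h2 : x ≠ -i) :
    eGen n i x = 0 := by
  rw [eGen, if_neg (by omega), if_neg h1, if_neg h2]

theorem rootWt_eq_one {n : ℕ} {i : ℤ} (hin : i < n) {x : ℤ} (h : x = i ∨ x = -(i + 1)) :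
    rootWt n i x = 1 := by
  unfold rootWt; split_ifs <;> omega

theorem rootWt_eq_neg_one {n : ℕ} {i : ℤ} (hi : 1 ≤ i) (hin : i < n) {x : ℤ}
    (h : x = i + 1 ∨ x = -i) : rootWt n i x = -1 := by
  unfold rootWt; split_ifs <;> omega

theorem rootWt_eq_zero {n : ℕ} {i : ℤ} (hin : i < n) {x : ℤ} (h1 : x ≠ i) (h2 : x ≠ i + 1)
    (h3 : x ≠ -i) (h4 : x ≠ -(i + 1)) :
    rootWt n i x = 0 := by
  unfold rootWt; split_ifs <;> omega

theorem va_swap {n : ℕ} (hn : 1 ≤ n) {x y : ℤ} (hx : x ∈ Iset n) (hy : y ∈ Iset n) (h : iLt x y)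
    (h0 : x + y ≠ 0) : va n y * va n x = (-qA) • (va n x * va n y) :=
  (isTypeCFamily_va n hn).swap x hx y hy h h0

theorem T_one_eq : (LaurentPolynomial.T 1 : AL) = qA := rfl
theorem T_neg_one_eq : (LaurentPolynomial.T (-1) : AL) = qAinv := rfl

theorem isCompatible_fGen_of_lt {n : ℕ} {i : ℤ} (hi : 1 ≤ i) (hin : i < n) :
    IsCompatible n 0 (-rootWt n i) (va n) (fGen n i) := by
  have hn : 1 ≤ n := by omega
  have hX := isTypeCFamily_va n hn
  have hq := qA_mul_qAinv
  have m1 : i ∈ Iset n := by rw [mem_Iset_iff]; omega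
  have m2 : i + 1 ∈ Iset n := by rw [mem_Iset_iff]; omega
  have m3 : -i ∈ Iset n := by rw [mem_Iset_iff]; omega
  have m4 : -(i + 1) ∈ Iset n := by rw [mem_Iset_iff]; omega
  have w1 : rootWt n i i = 1 := rootWt_eq_one hin (by omega)
  have w4 : rootWt n i (-(i + 1)) = 1 := rootWt_eq_one hin (by omega)
  have w2 : rootWt n i (i + 1) = -1 := rootWt_eq_neg_one hi hin (by omega)
  have w3 : rootWt n i (-i) = -1 := rootWt_eq_neg_one hi hin (by omega)
  have f1 := fGen_left hin
  have f2 := fGen_of_ne hin (x := i + 1) (by omega) (by omega)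
  have f3 := fGen_of_ne hin (x := -i) (by omega) (by omega)
  have f4 := fGen_right hi hin
  have s12 := va_swap hn m1 m2 (by unfold iLt; omega) (by omega)
  have s13 := va_swap hn m2 m3 (by unfold iLt; omega) (by omega)
  have s43 := va_swap hn m4 m3 (by unfold iLt; omega) (by omega)
  constructor
  · simp
  · intro x; simp [rootWt_neg hi]
  · intro x hx
    simp only [twistedLeibniz, Pi.zero_apply, Pi.neg_apply, LaurentPolynomial.T_zero, one_smul]
    by_cases h1 : x = i
    · subst h1
      rw [f1, w1, s12, T_neg_one_eq]
      match_scalars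
      linear_combination -hq
    by_cases h4 : x = -(i + 1)
    · subst h4
      rw [f4, w4, s43, T_neg_one_eq]
      match_scalars
      linear_combination -hq
    simp [fGen_of_ne hin h1 h4]
  · intro x hx y hy hxy h0
    simp only [twistedLeibniz, Pi.zero_apply, Pi.neg_apply, LaurentPolynomial.T_zero, one_smul]
    by_cases hs : x = i ∧ y = -(i + 1)
    · obtain ⟨rfl, rfl⟩ := hs
      rw [f1, f4, w1, w4, T_neg_one_eq]
      have hst := congrArg (qAinv • ·) (hX.step x hi hin)
      simp only [smul_add, smul_smul, smul_zero] at hst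
      rw [← sub_eq_zero, ← hst]
      match_scalars
      · linear_combination -hq
      · ring
      · linear_combination (-qA) * hq
      · linear_combination 0 * hq
    · have hd1 : va n y * fGen n i x =
          (-qA) • (LaurentPolynomial.T (-rootWt n i y) : AL) • (fGen n i x * va n y) := by
        rw [mem_Iset_iff] at hx hy
        by_cases h1 : x = i
        · subst h1
          rw [f1]
          by_cases h2 : y = x + 1
          · subst h2; rw [hX.sq _ m2]; simp
          · unfold iLt at hxy
            rw [rootWt_eq_zero hin (by omega) h2 (by omega) (by tauto), neg_zero,
              LaurentPolynomial.T_zero, one_smul]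
            exact va_swap hn m2 (by rw [mem_Iset_iff]; omega) (by unfold iLt; omega) (by omega)
        by_cases h4 : x = -(i + 1)
        · subst h4
          rw [f4]
          by_cases h2 : y = -i
          · subst h2; rw [hX.sq _ m3]; simp
          · unfold iLt at hxy
            rw [rootWt_eq_zero hin (by omega) (by omega) h2 (by omega), neg_zero,
              LaurentPolynomial.T_zero, one_smul]
            exact va_swap hn m3 (by rw [mem_Iset_iff]; omega) (by unfold iLt; omega) (by omega)
        simp [fGen_of_ne hin h1 h4]
      have hd2 : (LaurentPolynomial.T (-rootWt n i x) : AL) • (fGen n i y * va n x) =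
          (-qA) • (va n x * fGen n i y) := by
        rw [mem_Iset_iff] at hx hy
        by_cases h1 : y = i
        · subst h1
          unfold iLt at hxy
          rw [f1, rootWt_eq_zero hin (by omega) (by omega) (by omega) (by omega), neg_zero,
              LaurentPolynomial.T_zero, one_smul]
          exact va_swap hn (by rw [mem_Iset_iff]; omega) m2 (by unfold iLt; omega) (by omega)
        by_cases h4 : y = -(i + 1)
        · subst h4
          unfold iLt at hxy
          rw [f4, rootWt_eq_zero hin (by omega) (by omega) (by omega) (by omega), neg_zero,
              LaurentPolynomial.T_zero, one_smul]
          exact va_swap hn (by rw [mem_Iset_iff]; omega) m3 (by unfold iLt; omega) (by omega)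
        simp [fGen_of_ne hin h1 h4]
      rw [hd1, hd2, smul_add, add_comm]
  · simp only [twistedLeibniz, Pi.zero_apply, Pi.neg_apply, LaurentPolynomial.T_zero, one_smul]
    by_cases h : (n : ℤ) = i + 1
    · rw [h, f2, f4, w2, neg_neg, T_one_eq, s13]
      simp only [mul_zero, zero_mul, smul_zero, add_zero, zero_add]
      match_scalars
      ring
    · rw [fGen_of_ne hin (x := n) (by omega) (by omega),
        fGen_of_ne hin (x := -n) (by omega) (by omega)]
      simp
  · intro j hj hjn
    simp only [twistedLeibniz, Pi.zero_apply, Pi.neg_apply, LaurentPolynomial.T_zero, one_smul]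
    by_cases h1 : j = i
    · subst h1
      rw [f1, f2, f3, f4, w2, w3, neg_neg, T_one_eq, s13]
      simp only [mul_zero, zero_mul, smul_zero, add_zero, zero_add]
      match_scalars
      ring
    by_cases h2 : j = i + 1
    · subst h2
      rw [f2, f4, fGen_of_ne hin (x := i + 1 + 1) (by omega) (by omega),
        fGen_of_ne hin (x := -(i + 1 + 1)) (by omega) (by omega), w2, neg_neg, T_one_eq, s13]
      simp only [mul_zero, zero_mul, smul_zero, add_zero, zero_add]
      match_scalars
      ring
    by_cases h3 : j + 1 = i
    · subst h3
      rw [f1, f3, fGen_of_ne hin (x := j) (by omega) (by omega),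
        fGen_of_ne hin (x := -j) (by omega) (by omega), w3, neg_neg, T_one_eq, s13]
      simp only [mul_zero, zero_mul, smul_zero, add_zero, zero_add]
      match_scalars
      ring
    rw [fGen_of_ne hin (x := j) (by omega) (by omega),
      fGen_of_ne hin (x := -j) (by omega) (by omega),
      fGen_of_ne hin (x := j + 1) (by omega) (by omega),
      fGen_of_ne hin (x := -(j + 1)) (by omega) (by omega)]
    simp

theorem isCompatible_eGen_of_lt {n : ℕ} {i : ℤ} (hi : 1 ≤ i) (hin : i < n) :
    IsCompatible n (rootWt n i) 0 (va n) (eGen n i) := by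
  have hn : 1 ≤ n := by omega
  have hX := isTypeCFamily_va n hn
  have hq := qA_mul_qAinv
  have m1 : i ∈ Iset n := by rw [mem_Iset_iff]; omega
  have m2 : i + 1 ∈ Iset n := by rw [mem_Iset_iff]; omega
  have m3 : -i ∈ Iset n := by rw [mem_Iset_iff]; omega
  have m4 : -(i + 1) ∈ Iset n := by rw [mem_Iset_iff]; omega
  have w1 : rootWt n i i = 1 := rootWt_eq_one hin (by omega)
  have w4 : rootWt n i (-(i + 1)) = 1 := rootWt_eq_one hin (by omega)
  have w2 : rootWt n i (i + 1) = -1 := rootWt_eq_neg_one hi hin (by omega)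
  have w3 : rootWt n i (-i) = -1 := rootWt_eq_neg_one hi hin (by omega)
  have e1 := eGen_of_ne hin (x := i) (by omega) (by omega)
  have e2 := eGen_left hin
  have e3 := eGen_right hi hin
  have e4 := eGen_of_ne hin (x := -(i + 1)) (by omega) (by omega)
  have s12 := va_swap hn m1 m2 (by unfold iLt; omega) (by omega)
  have s14 := va_swap hn m1 m4 (by unfold iLt; omega) (by omega)
  have s43 := va_swap hn m4 m3 (by unfold iLt; omega) (by omega)
  constructor
  · exact rootWt_neg hi
  · simp
  · intro x hx
    simp only [twistedLeibniz, Pi.zero_apply, LaurentPolynomial.T_zero, one_smul]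
    by_cases h2 : x = i + 1
    · subst h2
      rw [e2, w2, s12, T_neg_one_eq]
      match_scalars
      linear_combination -hq
    by_cases h3 : x = -i
    · subst h3
      rw [e3, w3, s43, T_neg_one_eq]
      match_scalars
      linear_combination -hq
    simp [eGen_of_ne hin h2 h3]
  · intro x hx y hy hxy h0
    simp only [twistedLeibniz, Pi.zero_apply, LaurentPolynomial.T_zero, one_smul]
    by_cases hs : x = i + 1 ∧ y = -i
    · obtain ⟨rfl, rfl⟩ := hs
      rw [e2, e3, w2, w3, T_neg_one_eq]
      have hst := congrArg (qAinv • ·) (hX.step i hi hin)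
      simp only [smul_add, smul_smul, smul_zero] at hst
      rw [← sub_eq_zero, ← hst]
      match_scalars
      · ring
      · linear_combination -hq
      · linear_combination 0 * hq
      · linear_combination (-qA) * hq
    · have hd1 : (LaurentPolynomial.T (rootWt n i y) : AL) • (va n y * eGen n i x) =
          (-qA) • (eGen n i x * va n y) := by
        rw [mem_Iset_iff] at hx hy
        by_cases h2 : x = i + 1
        · subst h2
          unfold iLt at hxy
          rw [e2, rootWt_eq_zero hin (by omega) (by omega) (by tauto) (by omega),
            LaurentPolynomial.T_zero, one_smul]
          exact va_swap hn m1 (by rw [mem_Iset_iff]; omega) (by unfold iLt; omega) (by omega)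
        by_cases h3 : x = -i
        · subst h3
          unfold iLt at hxy
          rw [e3, rootWt_eq_zero hin (by omega) (by omega) (by omega) (by omega),
            LaurentPolynomial.T_zero, one_smul]
          exact va_swap hn m4 (by rw [mem_Iset_iff]; omega) (by unfold iLt; omega) (by omega)
        simp [eGen_of_ne hin h2 h3]
      have hd2 : eGen n i y * va n x =
          (-qA) • (LaurentPolynomial.T (rootWt n i x) : AL) • (va n x * eGen n i y) := by
        rw [mem_Iset_iff] at hx hy
        by_cases h2 : y = i + 1
        · subst h2
          rw [e2]
          by_cases h1 : x = i
          · subst h1; rw [hX.sq _ m1]; simp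
          · unfold iLt at hxy
            rw [rootWt_eq_zero hin h1 (by omega) (by omega) (by omega),
              LaurentPolynomial.T_zero, one_smul]
            exact va_swap hn (by rw [mem_Iset_iff]; omega) m1 (by unfold iLt; omega) (by omega)
        by_cases h3 : y = -i
        · subst h3
          rw [e3]
          by_cases h4 : x = -(i + 1)
          · subst h4; rw [hX.sq _ m4]; simp
          · unfold iLt at hxy
            rw [rootWt_eq_zero hin (by omega) (by tauto) (by omega) h4,
              LaurentPolynomial.T_zero, one_smul]
            exact va_swap hn (by rw [mem_Iset_iff]; omega) m4 (by unfold iLt; omega) (by omega)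
        simp [eGen_of_ne hin h2 h3]
      rw [hd1, hd2, smul_add, add_comm]
  · simp only [twistedLeibniz, Pi.zero_apply, LaurentPolynomial.T_zero, one_smul]
    by_cases h : (n : ℤ) = i + 1
    · rw [h, e2, e4, w4, T_one_eq, s14]
      simp only [mul_zero, zero_mul, smul_zero, add_zero, zero_add]
      match_scalars
      ring
    · rw [eGen_of_ne hin (x := n) (by omega) (by omega),
        eGen_of_ne hin (x := -n) (by omega) (by omega)]
      simp
  · intro j hj hjn
    simp only [twistedLeibniz, Pi.zero_apply, LaurentPolynomial.T_zero, one_smul]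
    by_cases h1 : j = i
    · subst h1
      rw [e1, e2, e3, e4, w1, w4, T_one_eq, s14]
      simp only [mul_zero, zero_mul, smul_zero, add_zero, zero_add]
      match_scalars
      ring
    by_cases h2 : j = i + 1
    · subst h2
      rw [e2, e4, eGen_of_ne hin (x := i + 1 + 1) (by omega) (by omega),
        eGen_of_ne hin (x := -(i + 1 + 1)) (by omega) (by omega), w4, T_one_eq, s14]
      simp only [mul_zero, zero_mul, smul_zero, add_zero, zero_add]
      match_scalars
      ring
    by_cases h3 : j + 1 = i
    · subst h3
      rw [e1, e3, eGen_of_ne hin (x := j) (by omega) (by omega),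
        eGen_of_ne hin (x := -j) (by omega) (by omega), w1, T_one_eq, s14]
      simp only [mul_zero, zero_mul, smul_zero, add_zero, zero_add]
      match_scalars
      ring
    rw [eGen_of_ne hin (x := j) (by omega) (by omega),
      eGen_of_ne hin (x := -j) (by omega) (by omega),
      eGen_of_ne hin (x := j + 1) (by omega) (by omega),
      eGen_of_ne hin (x := -(j + 1)) (by omega) (by omega)]
    simp

theorem fGen_last {n : ℕ} : fGen n n n = va n (-n) := by
  simp [fGen]

theorem fGen_last_of_ne {n : ℕ} {x : ℤ} (h : x ≠ n) : fGen n n x = 0 := by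
  simp [fGen, h]

theorem eGen_last {n : ℕ} : eGen n n (-n) = va n n := by
  simp [eGen]

theorem eGen_last_of_ne {n : ℕ} {x : ℤ} (h : x ≠ -n) : eGen n n x = 0 := by
  simp [eGen, h]

theorem rootWt_last {n : ℕ} : rootWt n n n = 2 := by
  simp [rootWt]

theorem rootWt_last_neg {n : ℕ} (hn : 1 ≤ n) : rootWt n n (-n) = -2 := by
  rw [rootWt_neg (by omega), rootWt_last]

theorem rootWt_last_of_ne {n : ℕ} {x : ℤ} (h1 : x ≠ n) (h2 : x ≠ -n) : rootWt n n x = 0 := by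
  simp [rootWt, h1, h2]

theorem T_neg_two_eq : (LaurentPolynomial.T (-2) : AL) = qAinv ^ 2 := by
  rw [qAinv, LaurentPolynomial.T_pow]; rfl

theorem isCompatible_fGen_last {n : ℕ} (hn : 1 ≤ n) :
    IsCompatible n 0 (-rootWt n n) (va n) (fGen n n) := by
  have hX := isTypeCFamily_va n hn
  have hq := qA_mul_qAinv
  have m1 : (n : ℤ) ∈ Iset n := by rw [mem_Iset_iff]; omega
  have m2 : -(n : ℤ) ∈ Iset n := by rw [mem_Iset_iff]; omega
  have f2 := fGen_last_of_ne (n := n) (x := -n) (by omega)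
  constructor
  · simp
  · intro x; simp [rootWt_neg (n := n) (i := n) (by omega)]
  · intro x hx
    simp only [twistedLeibniz, Pi.zero_apply, Pi.neg_apply, LaurentPolynomial.T_zero, one_smul]
    by_cases h : x = n
    · subst h
      rw [fGen_last, rootWt_last, hX.last, T_neg_two_eq]
      match_scalars
      linear_combination (-qA * qAinv - 1) * hq
    simp [fGen_last_of_ne h]
  · intro x hx y hy hxy h0
    simp only [twistedLeibniz, Pi.zero_apply, Pi.neg_apply, LaurentPolynomial.T_zero, one_smul]
    rw [mem_Iset_iff] at hx hy
    unfold iLt at hxy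
    have hd1 : va n y * fGen n n x =
        (-qA) • (LaurentPolynomial.T (-rootWt n n y) : AL) • (fGen n n x * va n y) := by
      by_cases h : x = n
      · subst h
        rw [fGen_last, rootWt_last_of_ne (by omega) (by omega), neg_zero,
          LaurentPolynomial.T_zero, one_smul]
        exact va_swap hn m2 (by rw [mem_Iset_iff]; omega) (by unfold iLt; omega) (by omega)
      simp [fGen_last_of_ne h]
    have hd2 : (LaurentPolynomial.T (-rootWt n n x) : AL) • (fGen n n y * va n x) =
        (-qA) • (va n x * fGen n n y) := by
      by_cases h : y = n
      · subst h
        rw [fGen_last, rootWt_last_of_ne (by omega) (by omega), neg_zero,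
          LaurentPolynomial.T_zero, one_smul]
        exact va_swap hn (by rw [mem_Iset_iff]; omega) m2 (by unfold iLt; omega) (by omega)
      simp [fGen_last_of_ne h]
    rw [hd1, hd2, smul_add, add_comm]
  · simp [twistedLeibniz, f2, fGen_last, hX.sq _ m2]
  · intro j hj hjn
    simp only [twistedLeibniz, Pi.zero_apply, Pi.neg_apply, LaurentPolynomial.T_zero, one_smul]
    rw [fGen_last_of_ne (x := j) (by omega), fGen_last_of_ne (x := -j) (by omega),
      fGen_last_of_ne (x := -(j + 1)) (by omega)]
    by_cases h : j + 1 = n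
    · rw [h, fGen_last, hX.sq _ m2]; simp
    · rw [fGen_last_of_ne h]; simp

theorem isCompatible_eGen_last {n : ℕ} (hn : 1 ≤ n) :
    IsCompatible n (rootWt n n) 0 (va n) (eGen n n) := by
  have hX := isTypeCFamily_va n hn
  have hq := qA_mul_qAinv
  have m1 : (n : ℤ) ∈ Iset n := by rw [mem_Iset_iff]; omega
  have m2 : -(n : ℤ) ∈ Iset n := by rw [mem_Iset_iff]; omega
  have e1 := eGen_last_of_ne (n := n) (x := n) (by omega)
  constructor
  · exact rootWt_neg (by omega)
  · simp
  · intro x hx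
    simp only [twistedLeibniz, Pi.zero_apply, LaurentPolynomial.T_zero, one_smul]
    by_cases h : x = -n
    · subst h
      rw [eGen_last, rootWt_last_neg hn, hX.last, T_neg_two_eq]
      match_scalars
      linear_combination (-qA * qAinv - 1) * hq
    simp [eGen_last_of_ne h]
  · intro x hx y hy hxy h0
    simp only [twistedLeibniz, Pi.zero_apply, LaurentPolynomial.T_zero, one_smul]
    rw [mem_Iset_iff] at hx hy
    unfold iLt at hxy
    have hd1 : (LaurentPolynomial.T (rootWt n n y) : AL) • (va n y * eGen n n x) =
        (-qA) • (eGen n n x * va n y) := by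
      by_cases h : x = -n
      · subst h
        rw [eGen_last, rootWt_last_of_ne (by omega) (by omega),
          LaurentPolynomial.T_zero, one_smul]
        exact va_swap hn m1 (by rw [mem_Iset_iff]; omega) (by unfold iLt; omega) (by omega)
      simp [eGen_last_of_ne h]
    have hd2 : eGen n n y * va n x =
        (-qA) • (LaurentPolynomial.T (rootWt n n x) : AL) • (va n x * eGen n n y) := by
      by_cases h : y = -n
      · subst h
        rw [eGen_last, rootWt_last_of_ne (by omega) (by omega),
          LaurentPolynomial.T_zero, one_smul]
        exact va_swap hn (by rw [mem_Iset_iff]; omega) m1 (by unfold iLt; omega) (by omega)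
      simp [eGen_last_of_ne h]
    rw [hd1, hd2, smul_add, add_comm]
  · simp [twistedLeibniz, e1, eGen_last, hX.sq _ m1]
  · intro j hj hjn
    simp only [twistedLeibniz, Pi.zero_apply, LaurentPolynomial.T_zero, one_smul]
    rw [eGen_last_of_ne (x := j) (by omega), eGen_last_of_ne (x := -j) (by omega),
      eGen_last_of_ne (x := j + 1) (by omega)]
    by_cases h : j + 1 = n
    · rw [h, eGen_last, hX.sq _ m1]; simp
    · rw [eGen_last_of_ne (x := -(j + 1)) (by omega)]; simp

theorem exists_orderList_eq {n : ℕ} {i : ℤ} (hi : 1 ≤ i) (hin : i < n) :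
    ∃ l₁ l₂ l₃ : List ℤ,
      orderList n = l₁ ++ i :: (i + 1) :: (l₂ ++ (-(i + 1)) :: (-i) :: l₃) ∧
      (∀ x ∈ l₁, x ∉ quad i) ∧ (∀ x ∈ l₂, x ∉ quad i) ∧ ∀ x ∈ l₃, x ∉ quad i := by
  obtain ⟨p, rfl⟩ : ∃ p : ℕ, i = ((1 + p : ℕ) : ℤ) := ⟨(i - 1).toNat, by omega⟩
  obtain ⟨r, rfl⟩ : ∃ r, n = p + (r + 1 + 1) := ⟨n - p - 2, by omega⟩
  refine ⟨(List.range' 1 p).map (fun k : ℕ => (k : ℤ)),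
    (List.range' (1 + p + 1 + 1) r).map (fun k : ℕ => (k : ℤ)) ++
      ((List.range' (1 + p + 1 + 1) r).map (fun k : ℕ => -(k : ℤ))).reverse,
    ((List.range' 1 p).map (fun k : ℕ => -(k : ℤ))).reverse, ?_, ?_, ?_, ?_⟩
  · rw [orderList, ← List.range'_append_1, List.range'_succ, List.range'_succ]
    simp only [List.map_append, List.map_cons, List.reverse_append, List.reverse_cons,
      List.append_assoc, List.cons_append, List.nil_append]
    push_cast
    rfl
  · simp only [List.mem_map, List.mem_range'_1]
    rintro _ ⟨k, hk, rfl⟩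
    simp only [quad, Finset.mem_insert, Finset.mem_singleton]
    omega
  · simp only [List.mem_append, List.mem_reverse, List.mem_map, List.mem_range'_1]
    rintro _ (⟨k, hk, rfl⟩ | ⟨k, hk, rfl⟩) <;>
    simp only [quad, Finset.mem_insert, Finset.mem_singleton] <;>
    omega
  · simp only [List.mem_reverse, List.mem_map, List.mem_range'_1]
    rintro _ ⟨k, hk, rfl⟩
    simp only [quad, Finset.mem_insert, Finset.mem_singleton]
    omega

theorem exists_orderList_last_eq {n : ℕ} (hn : 1 ≤ n) :
    ∃ l₁ l₂ : List ℤ, orderList n = l₁ ++ (n : ℤ) :: (-(n : ℤ)) :: l₂ ∧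
      (∀ x ∈ l₁, x ≠ n ∧ x ≠ -n) ∧ ∀ x ∈ l₂, x ≠ n ∧ x ≠ -n := by
  obtain ⟨p, rfl⟩ : ∃ p, n = p + (0 + 1) := ⟨n - 1, by omega⟩
  refine ⟨(List.range' 1 p).map (fun k : ℕ => (k : ℤ)),
    ((List.range' 1 p).map (fun k : ℕ => -(k : ℤ))).reverse, ?_, ?_, ?_⟩
  · rw [orderList, ← List.range'_append_1, List.range'_succ]
    simp [add_comm]
  · simp only [List.mem_map, List.mem_range'_1]
    rintro _ ⟨k, hk, rfl⟩
    omega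
  · simp only [List.mem_reverse, List.mem_map, List.mem_range'_1]
    rintro _ ⟨k, hk, rfl⟩
    omega

theorem card_inter_negSet {i : ℤ} (hi : 1 ≤ i) (S : Finset ℤ) :
    (S ∩ negSet S).card = ((S ∩ negSet S) \ quad i).card +
      ((if i ∈ S ∧ -i ∈ S then 2 else 0) + if i + 1 ∈ S ∧ -(i + 1) ∈ S then 2 else 0) := by
  rw [← Finset.card_sdiff_add_card_inter (S ∩ negSet S) (quad i)]
  congr 1
  have h : (S ∩ negSet S) ∩ quad i = (if i ∈ S ∧ -i ∈ S then {i, -i} else ∅) ∪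
      (if i + 1 ∈ S ∧ -(i + 1) ∈ S then {i + 1, -(i + 1)} else ∅) := by
    ext x
    have hneg : x ∈ negSet S ↔ -x ∈ S := by simp [negSet, neg_eq_iff_eq_neg]
    simp only [Finset.mem_inter, Finset.mem_union, hneg, quad, Finset.mem_insert,
      Finset.mem_singleton]
    constructor
    · rintro ⟨⟨h1, h2⟩, rfl | rfl | rfl | rfl⟩
      · simp [h1, h2]
      · rw [if_pos (c := i + 1 ∈ S ∧ -(i + 1) ∈ S) ⟨h1, h2⟩]; simp
      · rw [neg_neg] at h2; simp [h1, h2]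
      · rw [neg_neg] at h2; rw [if_pos (c := i + 1 ∈ S ∧ -(i + 1) ∈ S) ⟨h2, h1⟩]; simp
    · rintro (h | h) <;> split_ifs at h with hc <;>
        simp only [Finset.mem_insert, Finset.mem_singleton, Finset.notMem_empty] at h <;>
        rcases h with rfl | rfl <;> simp only [neg_neg, hc, true_or, or_true, and_self]
  rw [h, Finset.card_union_of_disjoint]
  · congr 1 <;> split_ifs
    · exact Finset.card_pair (by omega)
    · rfl
    · exact Finset.card_pair (by omega)
    · rfl
  · rw [Finset.disjoint_left]
    intro x hx hy
    split_ifs at hx hy <;>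
      simp only [Finset.mem_insert, Finset.mem_singleton, Finset.notMem_empty] at hx hy
    omega

theorem exists_barScalar_eq {i : ℤ} (hi : 1 ≤ i) (S : Finset ℤ) :
    ∃ σ : AL, ∀ S' : Finset ℤ, S'.card = S.card → (∀ x ∉ quad i, (x ∈ S' ↔ x ∈ S)) →
      barScalar S' = σ * ((if i ∈ S' ∧ -i ∈ S' then qAinv else 1) *
        if i + 1 ∈ S' ∧ -(i + 1) ∈ S' then qAinv else 1) := by
  refine ⟨(-qAinv) ^ (S.card * (S.card - 1) / 2) *
    LaurentPolynomial.T (-((((S ∩ negSet S) \ quad i).card / 2 : ℕ) : ℤ)), fun S' hc hS' => ?_⟩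
  have hs : (S' ∩ negSet S') \ quad i = (S ∩ negSet S) \ quad i := by
    ext x
    have hneg (R : Finset ℤ) : x ∈ negSet R ↔ -x ∈ R := by simp [negSet, neg_eq_iff_eq_neg]
    simp only [Finset.mem_sdiff, Finset.mem_inter, hneg]
    by_cases hx : x ∈ quad i
    · simp [hx]
    · have hx' : -x ∉ quad i := by
        simp only [quad, Finset.mem_insert, Finset.mem_singleton] at hx ⊢
        omega
      rw [hS' x hx, hS' _ hx']
  rw [barScalar, hc, card_inter_negSet hi S', hs, mul_assoc]
  congr 1
  generalize ((S ∩ negSet S) \ quad i).card = m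
  have hT {k : ℕ} {j : ℤ} (h : -((k / 2 : ℕ) : ℤ) = -((m / 2 : ℕ) : ℤ) + j) :
      (LaurentPolynomial.T (-((k / 2 : ℕ) : ℤ)) : AL) =
      LaurentPolynomial.T (-((m / 2 : ℕ) : ℤ)) * LaurentPolynomial.T j := by
    rw [h, LaurentPolynomial.T_add]
  split_ifs
  · rw [hT (j := -1 + -1) (by omega), LaurentPolynomial.T_add]; rfl
  · rw [mul_one]; exact hT (by omega)
  · rw [one_mul]; exact hT (by omega)
  · simp

/-- Factors on which a twisted derivation vanishes and the twists are trivial. -/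
structure IsInert {B : Type} [Ring B] [Algebra AL B] (U W : B →ₐ[AL] B) (D : B →ₗ[AL] B)
    (P : B) : Prop where
  left : U P = P
  right : W P = P
  map : D P = 0

theorem IsTwistedDerivation.isInert_prod {n : ℕ} {u w : ℤ → ℤ} {d : ℤ → LamAlg n}
    {U W : LamAlg n →ₐ[AL] LamAlg n} {D : LamAlg n →ₗ[AL] LamAlg n}
    (hD : IsTwistedDerivation n u w d U W D) (S : Finset ℤ) {l : List ℤ}
    (hl : ∀ x ∈ l, x ∈ Iset n ∧ u x = 0 ∧ w x = 0 ∧ d x = 0) :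
    IsInert U W D (l.map (vfac n S)).prod := by
  induction l with
  | nil => constructor <;> simp [hD.map_one]
  | cons x t ih =>
    obtain ⟨h1, h2, h3, h4⟩ := hl x List.mem_cons_self
    have ht := ih fun y hy => hl y (List.mem_cons_of_mem _ hy)
    have hx : IsInert U W D (vfac n S x) := by
      unfold vfac
      split_ifs
      · constructor
        · rw [hD.left_va x h1, h2, LaurentPolynomial.T_zero, one_smul]
        · rw [hD.right_va x h1, h3, LaurentPolynomial.T_zero, one_smul]
        · rw [hD.map_va x h1, h4]
      · constructor <;> simp [hD.map_one]
    rw [List.map_cons, List.prod_cons]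
    constructor
    · rw [_root_.map_mul, hx.left, ht.left]
    · rw [_root_.map_mul, hx.right, ht.right]
    · rw [hD.map_mul, hx.map, ht.map, mul_zero, zero_mul, add_zero]

theorem vset_induction {n : ℕ} (hn : 1 ≤ n) (φ ψ : LamAlg n →+ LamAlg n) (ρ : AL → AL)
    (hφ : ∀ (g : AL) x, φ (g • x) = ρ g • φ x) (hψ : ∀ (g : AL) x, ψ (g • x) = ρ g • ψ x)
    (h : ∀ S ⊆ Iset n, φ (vset n S) = ψ (vset n S)) (x : LamAlg n) : φ x = ψ x := by
  have hx : x ∈ Submodule.span AL (vset n '' {S | S ⊆ Iset n}) := by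
    rw [span_vset_eq_top hn]; trivial
  induction hx using Submodule.span_induction with
  | mem y hy => obtain ⟨S, hS, rfl⟩ := hy; exact h S hS
  | zero => rw [map_zero, map_zero]
  | add y z _ _ hy hz => rw [map_add, map_add, hy, hz]
  | smul g y _ hy => rw [hφ, hψ, hy]

theorem inter_quad_eq_iff {a b c d : ℤ} {S X : Finset ℤ} (hX : X ⊆ {a, b, d, c}) :
    S ∩ {a, b, d, c} = X ↔ (a ∈ S ↔ a ∈ X) ∧ (b ∈ S ↔ b ∈ X) ∧ (c ∈ S ↔ c ∈ X) ∧
      (d ∈ S ↔ d ∈ X) := by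
  constructor
  · rintro rfl; simp
  · rintro ⟨h1, h2, h3, h4⟩
    ext x
    rw [Finset.mem_inter]
    constructor
    · rintro ⟨hx, hx'⟩
      simp only [Finset.mem_insert, Finset.mem_singleton] at hx'
      rcases hx' with rfl | rfl | rfl | rfl <;> tauto
    · intro hx
      have hx' := hX hx
      refine ⟨?_, hx'⟩
      simp only [Finset.mem_insert, Finset.mem_singleton] at hx'
      rcases hx' with rfl | rfl | rfl | rfl <;> tauto

/-- A product of four optional letters separated by blocks. -/
def fourWord {B : Type} [Ring B] (P Q R x₁ x₂ x₃ x₄ : B) (t₁ t₂ t₃ t₄ : Bool) : B :=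
  P * (cond t₁ x₁ 1 * (cond t₂ x₂ 1 * (Q * (cond t₃ x₃ 1 * (cond t₄ x₄ 1 * R)))))

/-- A right twisted derivation sends the letter `x` to the letter `y`. -/
structure IsRightPair {B : Type} [Ring B] [Algebra AL B] (U W : B →ₐ[AL] B) (D : B →ₗ[AL] B)
    (x y : B) : Prop where
  map_left : D x = y
  map_right : D y = 0
  sq : ∀ z, y * (y * z) = 0
  fix_left : U x = x
  fix_right : U y = y
  twist_left : W x = qAinv • x
  twist_right : W y = qA • y

/-- A left twisted derivation sends the letter `x` to the letter `y`. -/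
structure IsLeftPair {B : Type} [Ring B] [Algebra AL B] (U W : B →ₐ[AL] B) (D : B →ₗ[AL] B)
    (x y : B) : Prop where
  map_left : D x = y
  map_right : D y = 0
  sq : ∀ z, y * (y * z) = 0
  fix_left : W x = x
  fix_right : W y = y
  twist_left : U x = qAinv • x
  twist_right : U y = qA • y

theorem IsRightPair.map_fourWord {B : Type} [Ring B] [Algebra AL B] {U W : B →ₐ[AL] B}
    {D : B →ₗ[AL] B} (hm : ∀ x y, D (x * y) = U x * D y + D x * W y)
    {P Q R a b c d : B} (hP : IsInert U W D P) (hQ : IsInert U W D Q) (hR : IsInert U W D R)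
    (h : IsRightPair U W D a b) (h' : IsRightPair U W D c d) (ta tb tc td : Bool) :
    D (fourWord P Q R a b c d ta tb tc td) =
      (if ta && !tb then (cond tc qAinv 1 * cond td qA 1 : AL) •
        fourWord P Q R a b c d false true tc td else 0) +
      (if tc && !td then fourWord P Q R a b c d ta tb false true else 0) := by
  cases ta <;> cases tb <;> cases tc <;> cases td <;>
  simp [fourWord, hm, hP.left, hP.map, hQ.left, hQ.right, hQ.map, hR.right, hR.map,
    h.map_left, h.map_right, h.sq, h.fix_left, h.fix_right, h.twist_left, h.twist_right,
    h'.map_left, h'.map_right, h'.sq, h'.fix_left, h'.fix_right, h'.twist_left, h'.twist_right,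
    smul_smul, qA_mul_qAinv, qAinv_mul_qA, add_comm, mul_add]

theorem IsRightPair.map_fourWord_rev {B : Type} [Ring B] [Algebra AL B] {U W : B →ₐ[AL] B}
    {D : B →ₗ[AL] B} (hm : ∀ x y, D (x * y) = U x * D y + D x * W y)
    {P Q R a b c d : B} (hP : IsInert U W D P) (hQ : IsInert U W D Q) (hR : IsInert U W D R)
    (h : IsRightPair U W D a b) (h' : IsRightPair U W D c d) (ta tb tc td : Bool) :
    D (fourWord P Q R d c b a td tc tb ta) =
      (if ta && !tb then fourWord P Q R d c b a td tc true false else 0) +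
      (if tc && !td then (cond ta qAinv 1 * cond tb qA 1 : AL) •
        fourWord P Q R d c b a true false tb ta else 0) := by
  cases ta <;> cases tb <;> cases tc <;> cases td <;>
  simp [fourWord, hm, hP.left, hP.map, hQ.left, hQ.right, hQ.map, hR.right, hR.map,
    h.map_left, h.map_right, h.sq, h.fix_left, h.fix_right, h.twist_left, h.twist_right,
    h'.map_left, h'.map_right, h'.sq, h'.fix_left, h'.fix_right, h'.twist_left, h'.twist_right,
    smul_smul, qA_mul_qAinv, qAinv_mul_qA, add_comm, mul_add]

theorem IsLeftPair.map_fourWord {B : Type} [Ring B] [Algebra AL B] {U W : B →ₐ[AL] B}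
    {D : B →ₗ[AL] B} (hm : ∀ x y, D (x * y) = U x * D y + D x * W y)
    {P Q R a b c d : B} (hP : IsInert U W D P) (hQ : IsInert U W D Q) (hR : IsInert U W D R)
    (h : IsLeftPair U W D b a) (h' : IsLeftPair U W D d c) (ta tb tc td : Bool) :
    D (fourWord P Q R a b c d ta tb tc td) =
      (if tb && !ta then fourWord P Q R a b c d true false tc td else 0) +
      (if td && !tc then (cond ta qA 1 * cond tb qAinv 1 : AL) •
        fourWord P Q R a b c d ta tb true false else 0) := by
  cases ta <;> cases tb <;> cases tc <;> cases td <;>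
  simp [fourWord, hm, hP.left, hP.map, hQ.left, hQ.right, hQ.map, hR.right, hR.map,
    h.map_left, h.map_right, h.sq, h.fix_left, h.fix_right, h.twist_left, h.twist_right,
    h'.map_left, h'.map_right, h'.sq, h'.fix_left, h'.fix_right, h'.twist_left, h'.twist_right,
    smul_smul, qA_mul_qAinv, qAinv_mul_qA, add_comm, mul_add]

theorem IsLeftPair.map_fourWord_rev {B : Type} [Ring B] [Algebra AL B] {U W : B →ₐ[AL] B}
    {D : B →ₗ[AL] B} (hm : ∀ x y, D (x * y) = U x * D y + D x * W y)
    {P Q R a b c d : B} (hP : IsInert U W D P) (hQ : IsInert U W D Q) (hR : IsInert U W D R)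
    (h : IsLeftPair U W D b a) (h' : IsLeftPair U W D d c) (ta tb tc td : Bool) :
    D (fourWord P Q R d c b a td tc tb ta) =
      (if tb && !ta then (cond tc qA 1 * cond td qAinv 1 : AL) •
        fourWord P Q R d c b a td tc false true else 0) +
      (if td && !tc then fourWord P Q R d c b a false true tb ta else 0) := by
  cases ta <;> cases tb <;> cases tc <;> cases td <;>
  simp [fourWord, hm, hP.left, hP.map, hQ.left, hQ.right, hQ.map, hR.right, hR.map,
    h.map_left, h.map_right, h.sq, h.fix_left, h.fix_right, h.twist_left, h.twist_right,
    h'.map_left, h'.map_right, h'.sq, h'.fix_left, h'.fix_right, h'.twist_left, h'.twist_right,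
    smul_smul, qA_mul_qAinv, add_comm, mul_add]

theorem fCases_eq {M : Type} [AddCommGroup M] [Module AL M] {a b c d : ℤ} (hab : a ≠ b)
    (hac : a ≠ c) (had : a ≠ d) (hbc : b ≠ c) (hbd : b ≠ d) (hcd : c ≠ d) (S : Finset ℤ) (y z : M) :
    (if S ∩ {a, b, d, c} = {a} then y
      else if S ∩ {a, b, d, c} = {c} then z
      else if S ∩ {a, b, d, c} = {a, c} then z + qAinv • y
      else if S ∩ {a, b, d, c} = {a, d} then qA • y
      else if S ∩ {a, b, d, c} = {b, c} then z
      else if S ∩ {a, b, d, c} = {a, c, d} then y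
      else if S ∩ {a, b, d, c} = {a, b, c} then z
      else 0) =
    (if decide (a ∈ S) && !decide (b ∈ S) then
        (cond (decide (c ∈ S)) qAinv 1 * cond (decide (d ∈ S)) qA 1 : AL) • y else 0) +
      if decide (c ∈ S) && !decide (d ∈ S) then z else 0 := by
  have key {X : Finset ℤ} (hX : ∀ x ∈ X, x = a ∨ x = b ∨ x = c ∨ x = d) :=
    inter_quad_eq_iff (a := a) (b := b) (c := c) (d := d) (S := S) (X := X) fun x hx => by
      simp only [Finset.mem_insert, Finset.mem_singleton]
      have := hX x hx
      tauto
  have k0 := key (X := {a}) (by simp)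
  have k1 := key (X := {c}) (by simp)
  have k2 := key (X := {a, c}) (by simp)
  have k3 := key (X := {a, d}) (by simp)
  have k4 := key (X := {b, c}) (by simp)
  have k5 := key (X := {a, c, d}) (by simp)
  have k6 := key (X := {a, b, c}) (by simp)
  simp only [k0, k1, k2, k3, k4, k5, k6, Finset.mem_insert, Finset.mem_singleton, hab, hab.symm, hac, hac.symm, had, had.symm,
    hbc, hbc.symm, hbd, hbd.symm, hcd, hcd.symm]
  by_cases h1 : a ∈ S <;> by_cases h2 : b ∈ S <;> by_cases h3 : c ∈ S <;> by_cases h4 : d ∈ S <;>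
  simp [h1, h2, h3, h4, qAinv_mul_qA, add_comm]

theorem eCases_eq {M : Type} [AddCommGroup M] [Module AL M] {a b c d : ℤ} (hab : a ≠ b)
    (hac : a ≠ c) (had : a ≠ d) (hbc : b ≠ c) (hbd : b ≠ d) (hcd : c ≠ d) (S : Finset ℤ) (y z : M) :
    (if S ∩ {a, b, d, c} = {d} then z
      else if S ∩ {a, b, d, c} = {b} then y
      else if S ∩ {a, b, d, c} = {b, d} then y + qAinv • z
      else if S ∩ {a, b, d, c} = {a, d} then qA • z
      else if S ∩ {a, b, d, c} = {b, c} then y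
      else if S ∩ {a, b, d, c} = {a, b, d} then z
      else if S ∩ {a, b, d, c} = {b, c, d} then y
      else 0) =
    (if decide (b ∈ S) && !decide (a ∈ S) then y else 0) +
      if decide (d ∈ S) && !decide (c ∈ S) then
        (cond (decide (a ∈ S)) qA 1 * cond (decide (b ∈ S)) qAinv 1 : AL) • z else 0 := by
  have key {X : Finset ℤ} (hX : ∀ x ∈ X, x = a ∨ x = b ∨ x = c ∨ x = d) :=
    inter_quad_eq_iff (a := a) (b := b) (c := c) (d := d) (S := S) (X := X) fun x hx => by
      simp only [Finset.mem_insert, Finset.mem_singleton]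
      have := hX x hx
      tauto
  have k0 := key (X := {d}) (by simp)
  have k1 := key (X := {b}) (by simp)
  have k2 := key (X := {b, d}) (by simp)
  have k3 := key (X := {a, d}) (by simp)
  have k4 := key (X := {b, c}) (by simp)
  have k5 := key (X := {a, b, d}) (by simp)
  have k6 := key (X := {b, c, d}) (by simp)
  simp only [k0, k1, k2, k3, k4, k5, k6, Finset.mem_insert, Finset.mem_singleton, hab, hab.symm, hac, hac.symm, had, had.symm,
    hbc, hbc.symm, hbd, hbd.symm, hcd, hcd.symm]
  by_cases h1 : a ∈ S <;> by_cases h2 : b ∈ S <;> by_cases h3 : c ∈ S <;> by_cases h4 : d ∈ S <;>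
  simp [h1, h2, h3, h4, qA_mul_qAinv, add_comm]

theorem IsTwistedDerivation.exists_fourWord {n : ℕ} {u w : ℤ → ℤ} {δ : ℤ → LamAlg n}
    {U W : LamAlg n →ₐ[AL] LamAlg n} {D : LamAlg n →ₗ[AL] LamAlg n}
    (hD : IsTwistedDerivation n u w δ U W D) {i : ℤ} (hi : 1 ≤ i) (hin : i < n)
    (hδ : ∀ x ∉ quad i, u x = 0 ∧ w x = 0 ∧ δ x = 0) (S : Finset ℤ) :
    ∃ P Q R P' Q' R' : LamAlg n, IsInert U W D P ∧ IsInert U W D Q ∧ IsInert U W D R ∧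
      IsInert U W D P' ∧ IsInert U W D Q' ∧ IsInert U W D R' ∧
      ∀ S' ⊆ Iset n, (∀ x ∉ quad i, (x ∈ S' ↔ x ∈ S)) →
        vset n S' = fourWord P Q R (va n i) (va n (i + 1)) (va n (-(i + 1))) (va n (-i))
          (decide (i ∈ S')) (decide (i + 1 ∈ S')) (decide (-(i + 1) ∈ S')) (decide (-i ∈ S')) ∧
        vsetRev n S' = fourWord P' Q' R' (va n (-i)) (va n (-(i + 1))) (va n (i + 1)) (va n i)
          (decide (-i ∈ S')) (decide (-(i + 1) ∈ S')) (decide (i + 1 ∈ S')) (decide (i ∈ S')) := by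
  obtain ⟨l₁, l₂, l₃, hl, h₁, h₂, h₃⟩ := exists_orderList_eq hi hin
  have hmem {l : List ℤ} (h : ∀ x ∈ l, x ∉ quad i) (hs : l ⊆ orderList n) :
      ∀ x ∈ l, x ∈ Iset n ∧ u x = 0 ∧ w x = 0 ∧ δ x = 0 := fun x hx =>
    ⟨mem_orderList.1 (hs hx), hδ x (h x hx)⟩
  have m₁ := hmem h₁ fun x hx => by rw [hl]; simp [hx]
  have m₂ := hmem h₂ fun x hx => by rw [hl]; simp [hx]
  have m₃ := hmem h₃ fun x hx => by rw [hl]; simp [hx]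
  refine ⟨_, _, _, _, _, _, hD.isInert_prod S m₁, hD.isInert_prod S m₂, hD.isInert_prod S m₃,
    hD.isInert_prod S (l := l₃.reverse) fun x hx => m₃ x (List.mem_reverse.1 hx),
    hD.isInert_prod S (l := l₂.reverse) fun x hx => m₂ x (List.mem_reverse.1 hx),
    hD.isInert_prod S (l := l₁.reverse) fun x hx => m₁ x (List.mem_reverse.1 hx), ?_⟩
  intro S' hS' hSS'
  have hfac {l : List ℤ} (h : ∀ x ∈ l, x ∉ quad i) :
      l.map (vfac n S') = l.map (vfac n S) := by
    refine List.map_congr_left fun x hx => ?_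
    unfold vfac
    simp only [hSS' x (h x hx)]
  have hcond (x : ℤ) : vfac n S' x = cond (decide (x ∈ S')) (va n x) 1 := by
    unfold vfac; by_cases h : x ∈ S' <;> simp [h]
  rw [vset_eq_prod hS', vsetRev_eq_prod hS', hl]
  simp only [List.reverse_append, List.reverse_cons, List.append_assoc, List.map_append,
    List.map_cons, List.prod_append, List.prod_cons, List.map_nil, List.prod_nil, hfac h₁, hfac h₂,
    hfac h₃, List.map_reverse, hcond, fourWord, mul_one, true_and]

theorem invert_qA : LaurentPolynomial.invert qA = qAinv := LaurentPolynomial.invert_T 1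

theorem invert_qAinv : LaurentPolynomial.invert qAinv = qA := LaurentPolynomial.invert_T (-1)

theorem va_mul_va_mul {n : ℕ} (hn : 1 ≤ n) {x : ℤ} (hx : x ∈ Iset n) (z : LamAlg n) :
    va n x * (va n x * z) = 0 := by
  have h := (isTypeCFamily_va n hn).sq x hx
  rw [← mul_assoc, h, zero_mul]

theorem insert_erase_move {n : ℕ} {S T : Finset ℤ} {x y : ℤ} (hS : S ⊆ Iset n) (hx : x ∈ S)
    (hy : y ∉ S) (hxT : x ∈ T) (hyT : y ∈ T) (hyn : y ∈ Iset n) :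
    insert y (S.erase x) ⊆ Iset n ∧ (insert y (S.erase x)).card = S.card ∧
      ∀ z ∉ T, (z ∈ insert y (S.erase x) ↔ z ∈ S) := by
  refine ⟨?_, ?_, ?_⟩
  · exact Finset.insert_subset hyn ((Finset.erase_subset _ _).trans hS)
  · rw [Finset.card_insert_of_notMem fun h => hy (Finset.mem_of_mem_erase h),
      Finset.card_erase_add_one hx]
  · intro z hz
    have h1 : z ≠ x := fun h => hz (h ▸ hxT)
    have h2 : z ≠ y := fun h => hz (h ▸ hyT)
    simp [h1, h2]

theorem bar_f_of_lt {n : ℕ} {i : ℤ} (hi : 1 ≤ i) (hin : i < n) (f : LamAlg n →ₗ[AL] LamAlg n)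
    (hf : ∀ S : Finset ℤ, S ⊆ Iset n → f (vset n S) =
        (if S ∩ quad i = {i} then vset n (insert (i + 1) (S.erase i))
         else if S ∩ quad i = {-(i + 1)} then vset n (insert (-i) (S.erase (-(i + 1))))
         else if S ∩ quad i = ({i, -(i + 1)} : Finset ℤ) then
           vset n (insert (-i) (S.erase (-(i + 1)))) + qAinv • vset n (insert (i + 1) (S.erase i))
         else if S ∩ quad i = ({i, -i} : Finset ℤ) then qA • vset n (insert (i + 1) (S.erase i))
         else if S ∩ quad i = ({i + 1, -(i + 1)} : Finset ℤ) then
           vset n (insert (-i) (S.erase (-(i + 1))))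
         else if S ∩ quad i = ({i, -(i + 1), -i} : Finset ℤ) then
           vset n (insert (i + 1) (S.erase i))
         else if S ∩ quad i = ({i, i + 1, -(i + 1)} : Finset ℤ) then
           vset n (insert (-i) (S.erase (-(i + 1))))
         else 0))
    (bar : LamAlg n →+ LamAlg n)
    (hbar1 : ∀ (g : AL) (x : LamAlg n), bar (g • x) = (LaurentPolynomial.invert g) • bar x)
    (hbar2 : ∀ S : Finset ℤ, S ⊆ Iset n → bar (vset n S) = barScalar S • vsetRev n S)
    (x : LamAlg n) : bar (f x) = f (bar x) := by
  have hn : 1 ≤ n := by omega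
  obtain ⟨U, W, D, hD⟩ := exists_isTwistedDerivation hn (isCompatible_fGen_of_lt hi hin)
  have ma : i ∈ Iset n := by rw [mem_Iset_iff]; omega
  have mb : i + 1 ∈ Iset n := by rw [mem_Iset_iff]; omega
  have mc : -(i + 1) ∈ Iset n := by rw [mem_Iset_iff]; omega
  have md : -i ∈ Iset n := by rw [mem_Iset_iff]; omega
  have hp : IsRightPair U W D (va n i) (va n (i + 1)) := by
    refine ⟨?_, ?_, va_mul_va_mul hn mb, ?_, ?_, ?_, ?_⟩
    · rw [hD.map_va _ ma, fGen_left hin]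
    · rw [hD.map_va _ mb, fGen_of_ne hin (by omega) (by omega)]
    · rw [hD.left_va _ ma]; simp
    · rw [hD.left_va _ mb]; simp
    · rw [hD.right_va _ ma, Pi.neg_apply, rootWt_eq_one hin (Or.inl rfl)]; rfl
    · rw [hD.right_va _ mb, Pi.neg_apply, rootWt_eq_neg_one hi hin (Or.inl rfl)]; rfl
  have hp' : IsRightPair U W D (va n (-(i + 1))) (va n (-i)) := by
    refine ⟨?_, ?_, va_mul_va_mul hn md, ?_, ?_, ?_, ?_⟩
    · rw [hD.map_va _ mc, fGen_right hi hin]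
    · rw [hD.map_va _ md, fGen_of_ne hin (by omega) (by omega)]
    · rw [hD.left_va _ mc]; simp
    · rw [hD.left_va _ md]; simp
    · rw [hD.right_va _ mc, Pi.neg_apply, rootWt_eq_one hin (Or.inr rfl)]; rfl
    · rw [hD.right_va _ md, Pi.neg_apply, rootWt_eq_neg_one hi hin (Or.inr rfl)]; rfl
  have hδ : ∀ x ∉ quad i,
      (0 : ℤ → ℤ) x = 0 ∧ (-rootWt n i) x = 0 ∧ fGen n i x = 0 := fun x hx => by
    simp only [quad, Finset.mem_insert, Finset.mem_singleton, not_or] at hx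
    exact ⟨rfl, by rw [Pi.neg_apply, rootWt_eq_zero hin hx.1 hx.2.1 hx.2.2.1 hx.2.2.2, neg_zero],
      fGen_of_ne hin hx.1 hx.2.2.2⟩
  have hw := hD.exists_fourWord hi hin hδ
  have hs := exists_barScalar_eq hi
  have hm := hD.map_mul
  have hquad : quad i = {i, i + 1, -i, -(i + 1)} := rfl
  clear hδ hD
  obtain ⟨b, hb⟩ : ∃ b, b = i + 1 := ⟨_, rfl⟩
  obtain ⟨c, hc⟩ : ∃ c, c = -(i + 1) := ⟨_, rfl⟩
  obtain ⟨d, hd⟩ : ∃ d, d = -i := ⟨_, rfl⟩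
  have hab : i ≠ b := by omega
  have hac : i ≠ c := by omega
  have had : i ≠ d := by omega
  have hbc : b ≠ c := by omega
  have hbd : b ≠ d := by omega
  have hcd : c ≠ d := by omega
  simp only [← hc, ← hd] at *
  simp only [← hb] at *
  clear hb hc hd
  have qa : i ∈ quad i := by rw [hquad]; simp
  have qb : b ∈ quad i := by rw [hquad]; simp
  have qc : c ∈ quad i := by rw [hquad]; simp
  have qd : d ∈ quad i := by rw [hquad]; simp
  have hfS (S : Finset ℤ) (hS : S ⊆ Iset n) : f (vset n S) =
      (if decide (i ∈ S) && !decide (b ∈ S) then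
        (cond (decide (c ∈ S)) qAinv 1 * cond (decide (d ∈ S)) qA 1 : AL) •
          vset n (insert b (S.erase i)) else 0) +
      if decide (c ∈ S) && !decide (d ∈ S) then vset n (insert d (S.erase c)) else 0 := by
    refine (hf S hS).trans ?_
    simp only [hquad]
    exact fCases_eq (M := LamAlg n) hab hac had hbc hbd hcd S _ _
  have hfD : ∀ x, f x = D x := by
    refine vset_induction hn f.toAddMonoidHom D.toAddMonoidHom id
      (fun g x => map_smul f g x) (fun g x => map_smul D g x) fun S hS => ?_
    obtain ⟨P, Q, R, P', Q', R', hP, hQ, hR, -, -, -, hw⟩ := hw S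
    refine (hfS S hS).trans (Eq.trans ?_ (congrArg D (hw S hS fun _ _ => Iff.rfl).1).symm)
    rw [hp.map_fourWord hm hP hQ hR hp']
    congr 1
    · by_cases h : i ∈ S ∧ b ∉ S
      · rw [if_pos (by simp [h]), if_pos (by simp [h])]
        obtain ⟨h1, -, h2⟩ := insert_erase_move hS h.1 h.2 qa qb mb
        rw [(hw _ h1 h2).1]
        simp [hab, hbc.symm, hbd.symm, hac.symm, had.symm]
      · rw [if_neg (by simpa using h), if_neg (by simpa using h)]
    · by_cases h : c ∈ S ∧ d ∉ S
      · rw [if_pos (by simp [h]), if_pos (by simp [h])]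
        obtain ⟨h1, -, h2⟩ := insert_erase_move hS h.1 h.2 qc qd md
        rw [(hw _ h1 h2).1]
        simp [hcd, hac, had, hbc, hbd]
      · rw [if_neg (by simpa using h), if_neg (by simpa using h)]
  refine vset_induction hn (bar.comp f.toAddMonoidHom) (f.toAddMonoidHom.comp bar)
    LaurentPolynomial.invert (fun g x => ?_) (fun g x => ?_) (fun S hS => ?_) x
  · exact (congrArg bar (map_smul f g x)).trans (hbar1 _ _)
  · exact (congrArg f (hbar1 g x)).trans (map_smul f _ _)
  obtain ⟨P, Q, R, P', Q', R', -, -, -, hP, hQ, hR, hw⟩ := hw S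
  obtain ⟨σ, hσ⟩ := hs S
  refine (congrArg bar (hfS S hS)).trans (Eq.trans ?_ (congrArg f (hbar2 S hS)).symm)
  rw [map_smul, hfD, (hw S hS fun _ _ => Iff.rfl).2, hp.map_fourWord_rev hm hP hQ hR hp', smul_add,
    map_add]
  congr 1
  · by_cases h : i ∈ S ∧ b ∉ S
    · rw [if_pos (by simp [h]), if_pos (by simp [h])]
      obtain ⟨h1, h3, h2⟩ := insert_erase_move hS h.1 h.2 qa qb mb
      rw [hbar1, hbar2 _ h1, (hw _ h1 h2).2, hσ _ h3 h2, hσ S rfl fun _ _ => Iff.rfl,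
        smul_smul]
      by_cases hc : c ∈ S <;> by_cases hd : d ∈ S <;>
      simp [h.1, h.2, hc, hd, hab, hbc.symm, hbd.symm, hac.symm, had.symm, invert_qA, invert_qAinv]
      all_goals
        congr 1
        grind [qA_mul_qAinv]
    · rw [if_neg (by simpa using h), if_neg (by simpa using h), map_zero, smul_zero]
  · by_cases h : c ∈ S ∧ d ∉ S
    · rw [if_pos (by simp [h]), if_pos (by simp [h])]
      obtain ⟨h1, h3, h2⟩ := insert_erase_move hS h.1 h.2 qc qd md
      rw [hbar2 _ h1, (hw _ h1 h2).2, hσ _ h3 h2, hσ S rfl fun _ _ => Iff.rfl,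
        smul_smul]
      by_cases ha : i ∈ S <;> by_cases hb : b ∈ S <;>
      simp [h.1, h.2, ha, hb, hcd, hac, had, hbc, hbd]
      all_goals
        congr 1
        grind [qA_mul_qAinv]
    · rw [if_neg (by simpa using h), if_neg (by simpa using h), map_zero, smul_zero]

theorem bar_e_of_lt {n : ℕ} {i : ℤ} (hi : 1 ≤ i) (hin : i < n) (e : LamAlg n →ₗ[AL] LamAlg n)
    (he : ∀ S : Finset ℤ, S ⊆ Iset n → e (vset n S) =
        (if S ∩ quad i = {-i} then vset n (insert (-(i + 1)) (S.erase (-i)))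
         else if S ∩ quad i = {i + 1} then vset n (insert i (S.erase (i + 1)))
         else if S ∩ quad i = ({i + 1, -i} : Finset ℤ) then
           vset n (insert i (S.erase (i + 1))) + qAinv • vset n (insert (-(i + 1)) (S.erase (-i)))
         else if S ∩ quad i = ({i, -i} : Finset ℤ) then
           qA • vset n (insert (-(i + 1)) (S.erase (-i)))
         else if S ∩ quad i = ({i + 1, -(i + 1)} : Finset ℤ) then vset n (insert i (S.erase (i + 1)))
         else if S ∩ quad i = ({i, i + 1, -i} : Finset ℤ) then
           vset n (insert (-(i + 1)) (S.erase (-i)))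
         else if S ∩ quad i = ({i + 1, -(i + 1), -i} : Finset ℤ) then
           vset n (insert i (S.erase (i + 1)))
         else 0))
    (bar : LamAlg n →+ LamAlg n)
    (hbar1 : ∀ (g : AL) (x : LamAlg n), bar (g • x) = (LaurentPolynomial.invert g) • bar x)
    (hbar2 : ∀ S : Finset ℤ, S ⊆ Iset n → bar (vset n S) = barScalar S • vsetRev n S)
    (x : LamAlg n) : bar (e x) = e (bar x) := by
  have hn : 1 ≤ n := by omega
  obtain ⟨U, W, D, hD⟩ := exists_isTwistedDerivation hn (isCompatible_eGen_of_lt hi hin)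
  have ma : i ∈ Iset n := by rw [mem_Iset_iff]; omega
  have mb : i + 1 ∈ Iset n := by rw [mem_Iset_iff]; omega
  have mc : -(i + 1) ∈ Iset n := by rw [mem_Iset_iff]; omega
  have md : -i ∈ Iset n := by rw [mem_Iset_iff]; omega
  have hp : IsLeftPair U W D (va n (i + 1)) (va n i) := by
    refine ⟨?_, ?_, va_mul_va_mul hn ma, ?_, ?_, ?_, ?_⟩
    · rw [hD.map_va _ mb, eGen_left hin]
    · rw [hD.map_va _ ma, eGen_of_ne hin (by omega) (by omega)]
    · rw [hD.right_va _ mb]; simp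
    · rw [hD.right_va _ ma]; simp
    · rw [hD.left_va _ mb, rootWt_eq_neg_one hi hin (Or.inl rfl)]; rfl
    · rw [hD.left_va _ ma, rootWt_eq_one hin (Or.inl rfl)]; rfl
  have hp' : IsLeftPair U W D (va n (-i)) (va n (-(i + 1))) := by
    refine ⟨?_, ?_, va_mul_va_mul hn mc, ?_, ?_, ?_, ?_⟩
    · rw [hD.map_va _ md, eGen_right hi hin]
    · rw [hD.map_va _ mc, eGen_of_ne hin (by omega) (by omega)]
    · rw [hD.right_va _ md]; simp
    · rw [hD.right_va _ mc]; simp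
    · rw [hD.left_va _ md, rootWt_eq_neg_one hi hin (Or.inr rfl)]; rfl
    · rw [hD.left_va _ mc, rootWt_eq_one hin (Or.inr rfl)]; rfl
  have hδ : ∀ x ∉ quad i,
      rootWt n i x = 0 ∧ (0 : ℤ → ℤ) x = 0 ∧ eGen n i x = 0 := fun x hx => by
    simp only [quad, Finset.mem_insert, Finset.mem_singleton, not_or] at hx
    exact ⟨rootWt_eq_zero hin hx.1 hx.2.1 hx.2.2.1 hx.2.2.2, rfl,
      eGen_of_ne hin hx.2.1 hx.2.2.1⟩
  have hw := hD.exists_fourWord hi hin hδ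
  have hs := exists_barScalar_eq hi
  have hm := hD.map_mul
  have hquad : quad i = {i, i + 1, -i, -(i + 1)} := rfl
  clear hδ hD
  obtain ⟨b, hb⟩ : ∃ b, b = i + 1 := ⟨_, rfl⟩
  obtain ⟨c, hc⟩ : ∃ c, c = -(i + 1) := ⟨_, rfl⟩
  obtain ⟨d, hd⟩ : ∃ d, d = -i := ⟨_, rfl⟩
  have hab : i ≠ b := by omega
  have hac : i ≠ c := by omega
  have had : i ≠ d := by omega
  have hbc : b ≠ c := by omega
  have hbd : b ≠ d := by omega
  have hcd : c ≠ d := by omega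
  simp only [← hc, ← hd] at *
  simp only [← hb] at *
  clear hb hc hd
  have qa : i ∈ quad i := by rw [hquad]; simp
  have qb : b ∈ quad i := by rw [hquad]; simp
  have qc : c ∈ quad i := by rw [hquad]; simp
  have qd : d ∈ quad i := by rw [hquad]; simp
  have heS (S : Finset ℤ) (hS : S ⊆ Iset n) : e (vset n S) =
      (if decide (b ∈ S) && !decide (i ∈ S) then vset n (insert i (S.erase b)) else 0) +
      if decide (d ∈ S) && !decide (c ∈ S) then
        (cond (decide (i ∈ S)) qA 1 * cond (decide (b ∈ S)) qAinv 1 : AL) •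
          vset n (insert c (S.erase d)) else 0 := by
    refine (he S hS).trans ?_
    simp only [hquad]
    exact eCases_eq (M := LamAlg n) hab hac had hbc hbd hcd S _ _
  have heD : ∀ x, e x = D x := by
    refine vset_induction hn e.toAddMonoidHom D.toAddMonoidHom id
      (fun g x => map_smul e g x) (fun g x => map_smul D g x) fun S hS => ?_
    obtain ⟨P, Q, R, P', Q', R', hP, hQ, hR, -, -, -, hw⟩ := hw S
    refine (heS S hS).trans (Eq.trans ?_ (congrArg D (hw S hS fun _ _ => Iff.rfl).1).symm)
    rw [hp.map_fourWord hm hP hQ hR hp']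
    congr 1
    · by_cases h : b ∈ S ∧ i ∉ S
      · rw [if_pos (by simp [h]), if_pos (by simp [h])]
        obtain ⟨h1, -, h2⟩ := insert_erase_move hS h.1 h.2 qb qa ma
        rw [(hw _ h1 h2).1]
        simp [hab.symm, hbc.symm, hbd.symm, hac.symm, had.symm]
      · rw [if_neg (by simpa using h), if_neg (by simpa using h)]
    · by_cases h : d ∈ S ∧ c ∉ S
      · rw [if_pos (by simp [h]), if_pos (by simp [h])]
        obtain ⟨h1, -, h2⟩ := insert_erase_move hS h.1 h.2 qd qc mc
        rw [(hw _ h1 h2).1]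
        simp [hcd.symm, hac, had, hbc, hbd]
      · rw [if_neg (by simpa using h), if_neg (by simpa using h)]
  refine vset_induction hn (bar.comp e.toAddMonoidHom) (e.toAddMonoidHom.comp bar)
    LaurentPolynomial.invert (fun g x => ?_) (fun g x => ?_) (fun S hS => ?_) x
  · exact (congrArg bar (map_smul e g x)).trans (hbar1 _ _)
  · exact (congrArg e (hbar1 g x)).trans (map_smul e _ _)
  obtain ⟨P, Q, R, P', Q', R', -, -, -, hP, hQ, hR, hw⟩ := hw S
  obtain ⟨σ, hσ⟩ := hs S
  refine (congrArg bar (heS S hS)).trans (Eq.trans ?_ (congrArg e (hbar2 S hS)).symm)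
  rw [map_smul, heD, (hw S hS fun _ _ => Iff.rfl).2, hp.map_fourWord_rev hm hP hQ hR hp', smul_add,
    map_add]
  congr 1
  · by_cases h : b ∈ S ∧ i ∉ S
    · rw [if_pos (by simp [h]), if_pos (by simp [h])]
      obtain ⟨h1, h3, h2⟩ := insert_erase_move hS h.1 h.2 qb qa ma
      rw [hbar2 _ h1, (hw _ h1 h2).2, hσ _ h3 h2, hσ S rfl fun _ _ => Iff.rfl,
        smul_smul]
      by_cases hc : c ∈ S <;> by_cases hd : d ∈ S <;>
      simp [h.1, h.2, hc, hd, hab, hab.symm, hbc.symm, hbd.symm, hac.symm, had.symm]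
      all_goals
        congr 1
        grind [qA_mul_qAinv]
    · rw [if_neg (by simpa using h), if_neg (by simpa using h), map_zero, smul_zero]
  · by_cases h : d ∈ S ∧ c ∉ S
    · rw [if_pos (by simp [h]), if_pos (by simp [h])]
      obtain ⟨h1, h3, h2⟩ := insert_erase_move hS h.1 h.2 qd qc mc
      rw [hbar1, hbar2 _ h1, (hw _ h1 h2).2, hσ _ h3 h2, hσ S rfl fun _ _ => Iff.rfl,
        smul_smul]
      by_cases ha : i ∈ S <;> by_cases hb : b ∈ S <;>
      simp [h.1, h.2, ha, hb, hcd.symm, hac, had, hbc, hbd, invert_qA, invert_qAinv]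
      all_goals
        congr 1
        grind [qA_mul_qAinv]
    · rw [if_neg (by simpa using h), if_neg (by simpa using h), map_zero, smul_zero]

theorem map_left_right_word {B : Type} [Ring B] [Algebra AL B] {U W : B →ₐ[AL] B}
    {D : B →ₗ[AL] B} (hm : ∀ x y, D (x * y) = U x * D y + D x * W y)
    {P R x y : B} (hP : IsInert U W D P) (hR : IsInert U W D R) (hx : D x = y) (hy : D y = 0)
    (hy2 : ∀ z, y * (y * z) = 0) {t : AL} (hW : W y = t • y) (p q : Bool) :
    D (P * (cond p x 1 * (cond q y 1 * R))) = if p && !q then P * (y * R) else 0 := by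
  cases p <;> cases q <;> simp [hm, hP.left, hP.map, hR.right, hR.map, hx, hy, hy2, hW]

theorem map_right_left_word {B : Type} [Ring B] [Algebra AL B] {U W : B →ₐ[AL] B}
    {D : B →ₗ[AL] B} (hm : ∀ x y, D (x * y) = U x * D y + D x * W y)
    {P R x y : B} (hP : IsInert U W D P) (hR : IsInert U W D R) (hx : D x = y) (hy : D y = 0)
    (hy2 : ∀ z, y * (y * z) = 0) {s : AL} (hU : U y = s • y) (p q : Bool) :
    D (P * (cond q y 1 * (cond p x 1 * R))) = if p && !q then P * (y * R) else 0 := by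
  cases p <;> cases q <;> simp [hm, hP.left, hP.map, hR.right, hR.map, hx, hy, hy2, hU]

theorem IsTwistedDerivation.exists_twoWord {n : ℕ} {u w : ℤ → ℤ} {δ : ℤ → LamAlg n}
    {U W : LamAlg n →ₐ[AL] LamAlg n} {D : LamAlg n →ₗ[AL] LamAlg n}
    (hD : IsTwistedDerivation n u w δ U W D) (hn : 1 ≤ n)
    (hδ : ∀ x : ℤ, x ≠ n → x ≠ -n → u x = 0 ∧ w x = 0 ∧ δ x = 0) (S : Finset ℤ) :
    ∃ P R P' R' : LamAlg n, IsInert U W D P ∧ IsInert U W D R ∧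
      IsInert U W D P' ∧ IsInert U W D R' ∧
      ∀ S' ⊆ Iset n, (∀ x : ℤ, x ≠ n → x ≠ -n → (x ∈ S' ↔ x ∈ S)) →
        vset n S' = P * (cond (decide ((n : ℤ) ∈ S')) (va n n) 1 *
          (cond (decide (-(n : ℤ) ∈ S')) (va n (-n)) 1 * R)) ∧
        vsetRev n S' = P' * (cond (decide (-(n : ℤ) ∈ S')) (va n (-n)) 1 *
          (cond (decide ((n : ℤ) ∈ S')) (va n n) 1 * R')) := by
  obtain ⟨l₁, l₂, hl, h₁, h₂⟩ := exists_orderList_last_eq hn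
  have hmem {l : List ℤ} (h : ∀ x ∈ l, x ≠ n ∧ x ≠ -n) (hs : l ⊆ orderList n) :
      ∀ x ∈ l, x ∈ Iset n ∧ u x = 0 ∧ w x = 0 ∧ δ x = 0 := fun x hx =>
    ⟨mem_orderList.1 (hs hx), hδ x (h x hx).1 (h x hx).2⟩
  have m₁ := hmem h₁ fun x hx => by rw [hl]; simp [hx]
  have m₂ := hmem h₂ fun x hx => by rw [hl]; simp [hx]
  refine ⟨_, _, _, _, hD.isInert_prod S m₁, hD.isInert_prod S m₂,
    hD.isInert_prod S (l := l₂.reverse) fun x hx => m₂ x (List.mem_reverse.1 hx),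
    hD.isInert_prod S (l := l₁.reverse) fun x hx => m₁ x (List.mem_reverse.1 hx), ?_⟩
  intro S' hS' hSS'
  have hfac {l : List ℤ} (h : ∀ x ∈ l, x ≠ n ∧ x ≠ -n) :
      l.map (vfac n S') = l.map (vfac n S) := by
    refine List.map_congr_left fun x hx => ?_
    unfold vfac
    simp only [hSS' x (h x hx).1 (h x hx).2]
  have hcond (x : ℤ) : vfac n S' x = cond (decide (x ∈ S')) (va n x) 1 := by
    unfold vfac; by_cases h : x ∈ S' <;> simp [h]
  rw [vset_eq_prod hS', vsetRev_eq_prod hS', hl]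
  simp only [List.reverse_append, List.reverse_cons, List.append_assoc, List.map_append,
    List.map_cons, List.prod_append, List.prod_cons, List.map_nil, List.prod_nil, hfac h₁, hfac h₂,
    List.map_reverse, hcond, mul_one, true_and]

theorem barScalar_insert_erase {n : ℕ} (hn : 1 ≤ n) {S : Finset ℤ} {x y : ℤ} (hS : S ⊆ Iset n)
    (hx : x ∈ S) (hy : y ∉ S) (hxy : (x = n ∧ y = -n) ∨ (x = -n ∧ y = n)) :
    barScalar (insert y (S.erase x)) = barScalar S := by
  have hyn : y ∈ Iset n := by rw [mem_Iset_iff]; omega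
  obtain ⟨h1, h2, h3⟩ := insert_erase_move (T := quad n) (y := y) hS hx hy
    (by simp only [quad, Finset.mem_insert, Finset.mem_singleton]; omega)
    (by simp only [quad, Finset.mem_insert, Finset.mem_singleton]; omega) hyn
  obtain ⟨σ, hσ⟩ := exists_barScalar_eq (i := n) (by omega) S
  have hout {S' : Finset ℤ} (h : S' ⊆ Iset n) : (n : ℤ) + 1 ∉ S' := fun h' => by
    have := mem_Iset_iff.1 (h h'); omega
  have hne : x ≠ y := by omega
  have a1 : ¬((n : ℤ) ∈ insert y (S.erase x) ∧ -(n : ℤ) ∈ insert y (S.erase x)) := fun h => by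
    have hx' : x ∉ insert y (S.erase x) := by simp [hne]
    rcases hxy with ⟨rfl, rfl⟩ | ⟨rfl, rfl⟩
    · exact hx' h.1
    · exact hx' h.2
  have a3 : ¬((n : ℤ) ∈ S ∧ -(n : ℤ) ∈ S) := by
    rcases hxy with ⟨rfl, rfl⟩ | ⟨rfl, rfl⟩ <;> tauto
  rw [hσ _ h2 h3, hσ S rfl fun _ _ => Iff.rfl, if_neg a1, if_neg fun h => hout h1 h.1,
    if_neg a3, if_neg fun h => hout hS h.1]

/-- An operator which agrees on standard monomials with a twisted derivation exchanging `n` and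
`-n` commutes with the bar map. -/
theorem bar_comm_of_last {n : ℕ} (hn : 1 ≤ n) {u w : ℤ → ℤ} {δ : ℤ → LamAlg n}
    {U W : LamAlg n →ₐ[AL] LamAlg n} {D : LamAlg n →ₗ[AL] LamAlg n}
    (hD : IsTwistedDerivation n u w δ U W D)
    (hδ : ∀ x : ℤ, x ≠ n → x ≠ -n → u x = 0 ∧ w x = 0 ∧ δ x = 0) {x y : ℤ}
    (hxy : (x = n ∧ y = -n) ∨ (x = -n ∧ y = n)) (hx : δ x = va n y) (hy : δ y = 0)
    (f : LamAlg n →ₗ[AL] LamAlg n)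
    (hf : ∀ S : Finset ℤ, S ⊆ Iset n → f (vset n S) =
      (if x ∈ S ∧ y ∉ S then vset n (insert y (S.erase x)) else 0))
    (bar : LamAlg n →+ LamAlg n)
    (hbar1 : ∀ (g : AL) (x : LamAlg n), bar (g • x) = (LaurentPolynomial.invert g) • bar x)
    (hbar2 : ∀ S : Finset ℤ, S ⊆ Iset n → bar (vset n S) = barScalar S • vsetRev n S)
    (z : LamAlg n) : bar (f z) = f (bar z) := by
  have mx : x ∈ Iset n := by rw [mem_Iset_iff]; omega
  have my : y ∈ Iset n := by rw [mem_Iset_iff]; omega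
  have hx' := (hD.map_va x mx).trans hx
  have hy' := (hD.map_va y my).trans hy
  have hm := hD.map_mul
  have hne : x ≠ y := by omega
  have hDS (S : Finset ℤ) (hS : S ⊆ Iset n) :
      D (vset n S) = (if x ∈ S ∧ y ∉ S then vset n (insert y (S.erase x)) else 0) ∧
      D (vsetRev n S) = (if x ∈ S ∧ y ∉ S then vsetRev n (insert y (S.erase x)) else 0) := by
    obtain ⟨P, R, P', R', hP, hR, hP', hR', hw⟩ := hD.exists_twoWord hn hδ S
    have hw0 := hw S hS fun _ _ _ => Iff.rfl
    have hmove (h : x ∈ S ∧ y ∉ S) := by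
      obtain ⟨h1, -, h3⟩ := insert_erase_move (T := {x, y}) (y := y) hS h.1 h.2 (by simp) (by simp) my
      refine hw _ h1 fun z hz1 hz2 => h3 z ?_
      simp only [Finset.mem_insert, Finset.mem_singleton]
      omega
    rw [hw0.1, hw0.2]
    rcases hxy with ⟨rfl, rfl⟩ | ⟨rfl, rfl⟩
    · rw [map_left_right_word hm hP hR hx' hy' (va_mul_va_mul hn my) (hD.right_va _ my),
        map_right_left_word hm hP' hR' hx' hy' (va_mul_va_mul hn my) (hD.left_va _ my)]
      by_cases h : (n : ℤ) ∈ S ∧ -(n : ℤ) ∉ S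
      · rw [if_pos h, if_pos h, (hmove h).1, (hmove h).2]
        simp [h, hne]
      · rw [if_neg h, if_neg h, if_neg (by simpa using h), if_neg (by simpa using h)]
        exact ⟨rfl, rfl⟩
    · rw [map_left_right_word hm hP' hR' hx' hy' (va_mul_va_mul hn my) (hD.right_va _ my),
        map_right_left_word hm hP hR hx' hy' (va_mul_va_mul hn my) (hD.left_va _ my)]
      by_cases h : -(n : ℤ) ∈ S ∧ (n : ℤ) ∉ S
      · rw [if_pos h, if_pos h, (hmove h).1, (hmove h).2]
        simp [h, hne]
      · rw [if_neg h, if_neg h, if_neg (by simpa using h), if_neg (by simpa using h)]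
        exact ⟨rfl, rfl⟩
  have hfD : ∀ z, f z = D z := vset_induction hn f.toAddMonoidHom D.toAddMonoidHom id
    (fun g x => map_smul f g x) (fun g x => map_smul D g x) fun S hS =>
      (hf S hS).trans (hDS S hS).1.symm
  refine vset_induction hn (bar.comp f.toAddMonoidHom) (f.toAddMonoidHom.comp bar)
    LaurentPolynomial.invert (fun g x => ?_) (fun g x => ?_) (fun S hS => ?_) z
  · exact (congrArg bar (map_smul f g x)).trans (hbar1 _ _)
  · exact (congrArg f (hbar1 g x)).trans (map_smul f _ _)
  refine (congrArg bar (hf S hS)).trans (Eq.trans ?_ (congrArg f (hbar2 S hS)).symm)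
  rw [map_smul, hfD, (hDS S hS).2]
  by_cases h : x ∈ S ∧ y ∉ S
  · rw [if_pos h, if_pos h, hbar2 _ (Finset.insert_subset my ((Finset.erase_subset _ _).trans hS)),
      barScalar_insert_erase hn hS h.1 h.2 hxy]
  · rw [if_neg h, if_neg h, map_zero, smul_zero]

theorem sum_map_rootWt {n : ℕ} {i : ℤ} (hi : 1 ≤ i) (hin : i ≤ n) (S : Finset ℤ) :
    ((orderList n).map fun x => if x ∈ S then rootWt n i x else 0).sum = alphaPair n i S := by
  have hzero {l : List ℤ} (h : ∀ x ∈ l, rootWt n i x = 0) :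
      (l.map fun x => if x ∈ S then rootWt n i x else 0).sum = 0 := by
    refine List.sum_eq_zero fun y hy => ?_
    obtain ⟨x, hx, rfl⟩ := List.mem_map.1 hy
    simp [h x hx]
  unfold alphaPair epsCoef
  rcases hin.lt_or_eq with hin | rfl
  · obtain ⟨l₁, l₂, l₃, hl, h₁, h₂, h₃⟩ := exists_orderList_eq hi hin
    have hq {x : ℤ} (hx : x ∉ quad i) : rootWt n i x = 0 := by
      simp only [quad, Finset.mem_insert, Finset.mem_singleton, not_or] at hx
      exact rootWt_eq_zero hin hx.1 hx.2.1 hx.2.2.1 hx.2.2.2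
    rw [hl, if_neg hin.ne]
    simp only [List.map_append, List.map_cons, List.sum_append, List.sum_cons,
      hzero fun x hx => hq (h₁ x hx), hzero fun x hx => hq (h₂ x hx),
      hzero fun x hx => hq (h₃ x hx), rootWt_eq_one hin (Or.inl rfl),
      rootWt_eq_one hin (Or.inr rfl), rootWt_eq_neg_one hi hin (Or.inl rfl),
      rootWt_eq_neg_one hi hin (Or.inr rfl)]
    split_ifs <;> rfl
  · obtain ⟨l₁, l₂, hl, h₁, h₂⟩ := exists_orderList_last_eq (n := n) (by omega)
    rw [hl, if_pos rfl]
    simp only [List.map_append, List.map_cons, List.sum_append, List.sum_cons,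
      hzero fun x hx => rootWt_last_of_ne (h₁ x hx).1 (h₁ x hx).2,
      hzero fun x hx => rootWt_last_of_ne (h₂ x hx).1 (h₂ x hx).2, rootWt_last,
      rootWt_last_neg (n := n) (by omega)]
    split_ifs <;> rfl

theorem bar_k {n : ℕ} (hn : 1 ≤ n) {i : ℤ} (hi : 1 ≤ i) (hin : i ≤ n)
    (k kinv : LamAlg n →ₗ[AL] LamAlg n)
    (hk : ∀ S : Finset ℤ, S ⊆ Iset n →
      k (vset n S) = (LaurentPolynomial.T (alphaPair n i S) : AL) • vset n S)
    (hkinv : ∀ x, kinv (k x) = x)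
    (bar : LamAlg n →+ LamAlg n)
    (hbar1 : ∀ (g : AL) (x : LamAlg n), bar (g • x) = (LaurentPolynomial.invert g) • bar x)
    (hbar2 : ∀ S : Finset ℤ, S ⊆ Iset n → bar (vset n S) = barScalar S • vsetRev n S)
    (x : LamAlg n) : bar (k x) = kinv (bar x) := by
  obtain ⟨K, hK⟩ := ((isTypeCFamily_va n hn).smul (rootWt_neg hi)).exists_lift
  have hprod (S : Finset ℤ) (l : List ℤ) (hl : ∀ x ∈ l, x ∈ Iset n) :
      K (l.map (vfac n S)).prod = (LaurentPolynomial.T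
        (l.map fun x => if x ∈ S then rootWt n i x else 0).sum : AL) •
          (l.map (vfac n S)).prod := by
    induction l with
    | nil => simp
    | cons y t ih =>
      have hy : K (vfac n S y) =
          (LaurentPolynomial.T (if y ∈ S then rootWt n i y else 0) : AL) • vfac n S y := by
        unfold vfac
        split_ifs
        · exact hK y (hl y List.mem_cons_self)
        · simp
      rw [List.map_cons, List.map_cons, List.prod_cons, List.sum_cons, map_mul, hy,
        ih fun z hz => hl z (List.mem_cons_of_mem _ hz), LaurentPolynomial.T_add,
        smul_mul_smul_comm]
  have hset (S : Finset ℤ) (hS : S ⊆ Iset n) :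
      K (vset n S) = (LaurentPolynomial.T (alphaPair n i S) : AL) • vset n S := by
    rw [vset_eq_prod hS, hprod S _ fun x hx => mem_orderList.1 hx, sum_map_rootWt hi hin]
  have hrev (S : Finset ℤ) (hS : S ⊆ Iset n) :
      K (vsetRev n S) = (LaurentPolynomial.T (alphaPair n i S) : AL) • vsetRev n S := by
    rw [vsetRev_eq_prod hS, hprod S _ fun x hx => mem_orderList.1 (List.mem_reverse.1 hx),
      List.map_reverse, List.sum_reverse, sum_map_rootWt hi hin]
  have hkK : ∀ x, k x = K x := vset_induction hn k.toAddMonoidHom K.toLinearMap.toAddMonoidHom id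
    (fun g x => map_smul k g x) (fun g x => map_smul K g x) fun S hS =>
      (hk S hS).trans (hset S hS).symm
  have hT (m : ℤ) : (LaurentPolynomial.T (-m) : AL) * LaurentPolynomial.T m = 1 := by
    rw [← LaurentPolynomial.T_add, neg_add_cancel, LaurentPolynomial.T_zero]
  have hkrev (S : Finset ℤ) (hS : S ⊆ Iset n) :
      kinv (vsetRev n S) = (LaurentPolynomial.T (-alphaPair n i S) : AL) • vsetRev n S := by
    have h := hkinv (vsetRev n S)
    rw [hkK, hrev S hS, map_smul] at h
    conv_rhs => rw [← h]
    rw [smul_smul, hT, one_smul]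
  refine vset_induction hn (bar.comp k.toAddMonoidHom) (kinv.toAddMonoidHom.comp bar)
    LaurentPolynomial.invert (fun g x => ?_) (fun g x => ?_) (fun S hS => ?_) x
  · exact (congrArg bar (map_smul k g x)).trans (hbar1 _ _)
  · exact (congrArg kinv (hbar1 g x)).trans (map_smul kinv _ _)
  refine (congrArg bar (hk S hS)).trans (Eq.trans ?_ (congrArg kinv (hbar2 S hS)).symm)
  rw [hbar1, hbar2 S hS, map_smul, hkrev S hS, LaurentPolynomial.invert_T, smul_comm]

/-- the bar map commutes with the Chevalley operators e_i and f_i and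
intertwines k_i with k_i⁻¹. -/
theorem stmt17 (n : ℕ) (hn : 1 ≤ n)
    (e f k kinv : ℤ → LamAlg n →ₗ[AL] LamAlg n)
    (hf : ∀ i : ℤ, 1 ≤ i → i < (n : ℤ) → ∀ S : Finset ℤ, S ⊆ Iset n →
      f i (vset n S) =
        (if S ∩ quad i = {i} then vset n (insert (i + 1) (S.erase i))
         else if S ∩ quad i = {-(i + 1)} then vset n (insert (-i) (S.erase (-(i + 1))))
         else if S ∩ quad i = ({i, -(i + 1)} : Finset ℤ) then
           vset n (insert (-i) (S.erase (-(i + 1)))) + qAinv • vset n (insert (i + 1) (S.erase i))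
         else if S ∩ quad i = ({i, -i} : Finset ℤ) then qA • vset n (insert (i + 1) (S.erase i))
         else if S ∩ quad i = ({i + 1, -(i + 1)} : Finset ℤ) then
           vset n (insert (-i) (S.erase (-(i + 1))))
         else if S ∩ quad i = ({i, -(i + 1), -i} : Finset ℤ) then
           vset n (insert (i + 1) (S.erase i))
         else if S ∩ quad i = ({i, i + 1, -(i + 1)} : Finset ℤ) then
           vset n (insert (-i) (S.erase (-(i + 1))))
         else 0))
    (hfn : ∀ S : Finset ℤ, S ⊆ Iset n →
      f (n : ℤ) (vset n S) =
        (if (n : ℤ) ∈ S ∧ -(n : ℤ) ∉ S then vset n (insert (-(n : ℤ)) (S.erase (n : ℤ))) else 0))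
    (he : ∀ i : ℤ, 1 ≤ i → i < (n : ℤ) → ∀ S : Finset ℤ, S ⊆ Iset n →
      e i (vset n S) =
        (if S ∩ quad i = {-i} then vset n (insert (-(i + 1)) (S.erase (-i)))
         else if S ∩ quad i = {i + 1} then vset n (insert i (S.erase (i + 1)))
         else if S ∩ quad i = ({i + 1, -i} : Finset ℤ) then
           vset n (insert i (S.erase (i + 1))) + qAinv • vset n (insert (-(i + 1)) (S.erase (-i)))
         else if S ∩ quad i = ({i, -i} : Finset ℤ) then
           qA • vset n (insert (-(i + 1)) (S.erase (-i)))
         else if S ∩ quad i = ({i + 1, -(i + 1)} : Finset ℤ) then vset n (insert i (S.erase (i + 1)))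
         else if S ∩ quad i = ({i, i + 1, -i} : Finset ℤ) then
           vset n (insert (-(i + 1)) (S.erase (-i)))
         else if S ∩ quad i = ({i + 1, -(i + 1), -i} : Finset ℤ) then
           vset n (insert i (S.erase (i + 1)))
         else 0))
    (hen : ∀ S : Finset ℤ, S ⊆ Iset n →
      e (n : ℤ) (vset n S) =
        (if -(n : ℤ) ∈ S ∧ (n : ℤ) ∉ S then vset n (insert (n : ℤ) (S.erase (-(n : ℤ)))) else 0))
    (hk : ∀ i ∈ Finset.Icc (1 : ℤ) (n : ℤ), ∀ S : Finset ℤ, S ⊆ Iset n →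
      k i (vset n S) = (LaurentPolynomial.T (alphaPair n i S) : AL) • vset n S)
    (hkinv : ∀ i ∈ Finset.Icc (1 : ℤ) (n : ℤ),
      (∀ x : LamAlg n, k i (kinv i x) = x) ∧ (∀ x : LamAlg n, kinv i (k i x) = x))
    (bar : LamAlg n →+ LamAlg n)
    (hbar1 : ∀ (g : AL) (x : LamAlg n), bar (g • x) = (LaurentPolynomial.invert g) • bar x)
    (hbar2 : ∀ S : Finset ℤ, S ⊆ Iset n → bar (vset n S) = barScalar S • vsetRev n S) :
    ∀ i ∈ Finset.Icc (1 : ℤ) (n : ℤ), ∀ x : LamAlg n,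
      bar (e i x) = e i (bar x) ∧ bar (f i x) = f i (bar x) ∧ bar (k i x) = kinv i (bar x) := by
  intro i hi x
  have hi' := Finset.mem_Icc.1 hi
  refine ⟨?_, ?_, bar_k hn hi'.1 hi'.2 (k i) (kinv i) (hk i hi) (hkinv i hi).2 bar hbar1 hbar2 x⟩
  · rcases hi'.2.lt_or_eq with h | rfl
    · exact bar_e_of_lt hi'.1 h (e i) (he i hi'.1 h) bar hbar1 hbar2 x
    · obtain ⟨U, W, D, hD⟩ := exists_isTwistedDerivation hn (isCompatible_eGen_last hn)
      exact bar_comm_of_last hn hD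
        (fun y h1 h2 => ⟨rootWt_last_of_ne h1 h2, rfl, eGen_last_of_ne h2⟩)
        (Or.inr ⟨rfl, rfl⟩) eGen_last (eGen_last_of_ne (by omega)) (e n) hen bar hbar1 hbar2 x
  · rcases hi'.2.lt_or_eq with h | rfl
    · exact bar_f_of_lt hi'.1 h (f i) (hf i hi'.1 h) bar hbar1 hbar2 x
    · obtain ⟨U, W, D, hD⟩ := exists_isTwistedDerivation hn (isCompatible_fGen_last hn)
      exact bar_comm_of_last hn hD
        (fun y h1 h2 => ⟨rfl, by rw [Pi.neg_apply, rootWt_last_of_ne h1 h2, neg_zero],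
          fGen_last_of_ne h1⟩)
        (Or.inl ⟨rfl, rfl⟩) fGen_last (fGen_last_of_ne (by omega)) (f n) hfn bar hbar1 hbar2 x

end
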